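/- Let N ≥ 3, let p, q > 0 with pq > 1, and let a, b > −2. Then there exists a constant C > 0 depending only on N, p, q, a, b such that every nonnegative solution (u,v) of the Hénon–Lane–Emden system (HLE) satisfies, for every R > 0: (i) ∫_{B_R} |x|^b u(x)^q dx ≤ C R^{N−2−β̃} and ∫_{B_R} |x|^a v(x)^p dx ≤ C R^{N−2−α̃}; and (ii) for every γ ∈ (0,1], the spherical averages satisfy (1/σ(S_R)) ∫_{S_R} u^γ dσ ≤ C R^{−γα̃} and (1/σ(S_R)) ∫_{S_R} v^γ dσ ≤ C R^{−γβ̃}. -/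

import Mathlib

open MeasureTheory Metric Set

noncomputable section

/-- Euclidean space `ℝ^N`. -/
abbrev Euc (N : ℕ) := EuclideanSpace ℝ (Fin N)

/-- The Laplacian of a function `f : ℝ^N → ℝ`, as the sum of the pure second
partial derivatives. -/
def lap {N : ℕ} (f : Euc N → ℝ) (x : Euc N) : ℝ :=
  ∑ i : Fin N, iteratedFDeriv ℝ 2 f x ![EuclideanSpace.single i 1, EuclideanSpace.single i 1]

/-- `(u, v)` is a solution of the Hénon–Lane–Emden system
`-Δu = |x|^a |v|^{p-1} v`, `-Δv = |x|^b |u|^{q-1} u` on `ℝ^N \ {0}`: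
`u, v` are `C²` on `ℝ^N \ {0}`, continuous on `ℝ^N`, and satisfy the equations pointwise. -/
def IsHLESol {N : ℕ} (p q a b : ℝ) (u v : Euc N → ℝ) : Prop :=
  ContDiffOn ℝ 2 u {x : Euc N | x ≠ 0} ∧ ContDiffOn ℝ 2 v {x : Euc N | x ≠ 0} ∧
  Continuous u ∧ Continuous v ∧
  (∀ x : Euc N, x ≠ 0 → -lap u x = ‖x‖ ^ a * (|v x| ^ (p - 1) * v x)) ∧
  (∀ x : Euc N, x ≠ 0 → -lap v x = ‖x‖ ^ b * (|u x| ^ (q - 1) * u x))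

/-- Stability of a (positive) solution of the Hénon–Lane–Emden system on an open set `Ω`:
there exist positive `C²` functions `ξ, ζ` on `Ω` with
`-Δξ ≥ p |x|^a v^{p-1} ζ` and `-Δζ ≥ q |x|^b u^{q-1} ξ` on `Ω`. -/
def HLEStableOn {N : ℕ} (p q a b : ℝ) (u v : Euc N → ℝ) (Ω : Set (Euc N)) : Prop :=
  ∃ ξ ζ : Euc N → ℝ, ContDiffOn ℝ 2 ξ Ω ∧ ContDiffOn ℝ 2 ζ Ω ∧
    (∀ x ∈ Ω, 0 < ξ x) ∧ (∀ x ∈ Ω, 0 < ζ x) ∧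
    (∀ x ∈ Ω, p * ‖x‖ ^ a * v x ^ (p - 1) * ζ x ≤ -lap ξ x) ∧
    (∀ x ∈ Ω, q * ‖x‖ ^ b * u x ^ (q - 1) * ξ x ≤ -lap ζ x)

/-- Stability outside a compact set `K`: stability on every open set whose closure is
compact and contained in `ℝ^N \ K`. -/
def HLEStableOutside {N : ℕ} (p q a b : ℝ) (u v : Euc N → ℝ) (K : Set (Euc N)) : Prop :=
  IsCompact K ∧
    ∀ Ω : Set (Euc N), IsOpen Ω → IsCompact (closure Ω) → closure Ω ⊆ Kᶜ →
      HLEStableOn p q a b u v Ω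

/-- `(u, v)` solves the Lane–Emden system `-Δu = |v|^{p-1} v`, `-Δv = |u|^{q-1} u` on `ℝ^N`. -/
def IsLESol {N : ℕ} (p q : ℝ) (u v : Euc N → ℝ) : Prop :=
  (∀ x : Euc N, -lap u x = |v x| ^ (p - 1) * v x) ∧
  (∀ x : Euc N, -lap v x = |u x| ^ (q - 1) * u x)

/-- Stability of a (positive) solution of the Lane–Emden system on an open set `Ω`. -/
def LEStableOn {N : ℕ} (p q : ℝ) (u v : Euc N → ℝ) (Ω : Set (Euc N)) : Prop :=
  ∃ ξ ζ : Euc N → ℝ, ContDiffOn ℝ 2 ξ Ω ∧ ContDiffOn ℝ 2 ζ Ω ∧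
    (∀ x ∈ Ω, 0 < ξ x) ∧ (∀ x ∈ Ω, 0 < ζ x) ∧
    (∀ x ∈ Ω, p * v x ^ (p - 1) * ζ x ≤ -lap ξ x) ∧
    (∀ x ∈ Ω, q * u x ^ (q - 1) * ξ x ≤ -lap ζ x)

/-- A function on `ℝ^N` is polynomially bounded. -/
def PolyBounded {N : ℕ} (w : Euc N → ℝ) : Prop :=
  ∃ K L R : ℝ, 0 < K ∧ 0 < L ∧ ∀ x : Euc N, R ≤ ‖x‖ → |w x| ≤ K * ‖x‖ ^ L

/-- The polynomial `G` from Theorem 1.4 (iii). -/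
def Gpoly (p q x : ℝ) : ℝ :=
  x ^ 4 - (4 * p * q * (q + 1) / (p + 1)) * x ^ 2 +
    (2 * p * q * (q + 1) * (p + q + 2) / (p + 1) ^ 2) * x -
    p * q * (q + 1) ^ 2 / (p + 1) ^ 2

open scoped Topology

lemma lap_eq_sum_fderiv {N : ℕ} {f : Euc N → ℝ} {x : Euc N} (hf : ContDiffAt ℝ 2 f x) :
    lap f x = ∑ i : Fin N, fderiv ℝ (fun y => fderiv ℝ f y (EuclideanSpace.single i 1)) x
      (EuclideanSpace.single i 1) := by
  unfold lap
  refine Finset.sum_congr rfl fun i _ => ?_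
  rw [iteratedFDeriv_two_apply]
  have h : DifferentiableAt ℝ (fderiv ℝ f) x :=
    (hf.fderiv_right (m := 1) (by norm_num)).differentiableAt (by norm_num)
  rw [fderiv_clm_apply h (differentiableAt_const _)]
  simp

lemma abs_lap_le {N : ℕ} (f : Euc N → ℝ) (x : Euc N) :
    |lap f x| ≤ N * ‖iteratedFDeriv ℝ 2 f x‖ := by
  unfold lap
  refine (Finset.abs_sum_le_sum_abs _ _).trans ?_
  have : ∀ i ∈ (Finset.univ : Finset (Fin N)), |iteratedFDeriv ℝ 2 f x
      ![EuclideanSpace.single i 1, EuclideanSpace.single i 1]| ≤ ‖iteratedFDeriv ℝ 2 f x‖ := by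
    intro i _
    have := (iteratedFDeriv ℝ 2 f x).le_opNorm
      ![EuclideanSpace.single i 1, EuclideanSpace.single i 1]
    simpa [Fin.prod_univ_two] using this
  refine (Finset.sum_le_sum this).trans ?_
  simp

lemma lap_eq_zero_of_notMem_tsupport {N : ℕ} {f : Euc N → ℝ} {x : Euc N} (hx : x ∉ tsupport f) :
    lap f x = 0 := by
  have h := abs_lap_le f x
  have : iteratedFDeriv ℝ 2 f x = 0 := by
    by_contra h'
    exact hx (support_iteratedFDeriv_subset (𝕜 := ℝ) 2 (by simpa using h'))
  rw [this] at h
  simpa using h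

lemma lap_sub {N : ℕ} {f g : Euc N → ℝ} {x : Euc N} (hf : ContDiffAt ℝ 2 f x)
    (hg : ContDiffAt ℝ 2 g x) : lap (fun y => f y - g y) x = lap f x - lap g x := by
  unfold lap
  have := iteratedFDeriv_sub_apply (i := 2) hf hg
  have h2 : (fun y => f y - g y) = f - g := rfl
  rw [h2, this]
  simp

lemma continuous_lap {N : ℕ} {f : Euc N → ℝ} (hf : ContDiff ℝ 2 f) : Continuous (lap f) := by
  unfold lap
  have := hf.continuous_iteratedFDeriv (m := 2) le_rfl
  fun_prop

lemma continuousOn_lap {N : ℕ} {f : Euc N → ℝ} {s : Set (Euc N)} (hs : IsOpen s)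
    (hf : ContDiffOn ℝ 2 f s) : ContinuousOn (lap f) s := by
  unfold lap
  have h := hf.continuousOn_iteratedFDerivWithin (m := 2) le_rfl hs.uniqueDiffOn
  have : ContinuousOn (iteratedFDeriv ℝ 2 f) s :=
    h.congr fun x hx => (iteratedFDerivWithin_of_isOpen 2 hs hx).symm
  refine continuousOn_finsetSum _ fun i _ => ?_
  intro x hx
  exact ((ContinuousMultilinearMap.apply ℝ (fun _ : Fin 2 => Euc N) ℝ
    ![EuclideanSpace.single i 1, EuclideanSpace.single i 1]).continuous.continuousAt
    |>.comp_continuousWithinAt (this x hx))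

lemma hasCompactSupport_lap {N : ℕ} {f : Euc N → ℝ} (hf : HasCompactSupport f) :
    HasCompactSupport (lap f) :=
  HasCompactSupport.intro hf fun _ hx => lap_eq_zero_of_notMem_tsupport hx

/-- A product `g * h` is integrable if `g` is continuous with compact support inside an open
set on which `h` is continuous. -/
lemma integrable_mul_of_tsupport_subset {N : ℕ} {g h : Euc N → ℝ} {s : Set (Euc N)}
    (hs : IsOpen s) (hg : Continuous g) (hgc : HasCompactSupport g) (hgs : tsupport g ⊆ s)
    (hh : ContinuousOn h s) : Integrable (fun x => g x * h x) := by
  have hsub : tsupport (fun x => g x * h x) ⊆ tsupport g := tsupport_mul_subset_left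
  have : Continuous (fun x => g x * h x) :=
    (hg.continuousOn.mul hh).continuous_of_tsupport_subset hs (hsub.trans hgs)
  exact this.integrable_of_hasCompactSupport hgc.mul_right

/-- Integration by parts for the Laplacian. -/
lemma integral_mul_lap_comm {N : ℕ} {g u : Euc N → ℝ} {s : Set (Euc N)}
    (hs : IsOpen s) (hg : ContDiff ℝ 2 g) (hgc : HasCompactSupport g) (hgs : tsupport g ⊆ s)
    (hu : ContDiffOn ℝ 2 u s) :
    ∫ x, g x * lap u x = ∫ x, u x * lap g x := by
  have hdu : ContDiffOn ℝ 1 (fderiv ℝ u) s := hu.fderiv_of_isOpen hs (by norm_num)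
  have hdg : ContDiff ℝ 1 (fderiv ℝ g) := hg.fderiv_right (by norm_num)
  have hg1 : Differentiable ℝ g := hg.differentiable (by norm_num)
  have hua : ∀ x ∈ s, DifferentiableAt ℝ u x := fun x hx =>
    (hu.contDiffAt (hs.mem_nhds hx)).differentiableAt (by norm_num)
  set e : Fin N → Euc N := fun i => EuclideanSpace.single i 1 with he
  have hdui : ∀ i, ContDiffOn ℝ 1 (fun y => fderiv ℝ u y (e i)) s := fun i =>
    hdu.clm_apply contDiffOn_const
  have hdgi : ∀ i, ContDiff ℝ 1 (fun y => fderiv ℝ g y (e i)) := fun i =>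
    hdg.clm_apply contDiff_const
  have htd : ∀ i, tsupport (fun y => fderiv ℝ g y (e i)) ⊆ tsupport g := fun i =>
    tsupport_fderiv_apply_subset ℝ (e i)
  have hcd : ∀ i, HasCompactSupport (fun y => fderiv ℝ g y (e i)) := fun i =>
    hgc.of_isClosed_subset (isClosed_tsupport _) (htd i)
  have htdd : ∀ i, tsupport (fun x => fderiv ℝ (fun y => fderiv ℝ g y (e i)) x (e i))
      ⊆ tsupport g := fun i => (tsupport_fderiv_apply_subset ℝ (e i)).trans (htd i)
  have hcdd : ∀ i, HasCompactSupport
      (fun x => fderiv ℝ (fun y => fderiv ℝ g y (e i)) x (e i)) := fun i =>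
    hgc.of_isClosed_subset (isClosed_tsupport _) (htdd i)
  have hddu : ∀ i, ContinuousOn (fun x => fderiv ℝ (fun y => fderiv ℝ u y (e i)) x (e i)) s :=
    fun i => ((hdui i).continuousOn_fderiv_of_isOpen hs (by norm_num)).clm_apply
      continuousOn_const
  have hddg : ∀ i, Continuous (fun x => fderiv ℝ (fun y => fderiv ℝ g y (e i)) x (e i)) :=
    fun i => ((hdgi i).continuous_fderiv (by norm_num)).clm_apply continuous_const
  have I1 : ∀ i, Integrable (fun x => g x * fderiv ℝ (fun y => fderiv ℝ u y (e i)) x (e i)) :=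
    fun i => integrable_mul_of_tsupport_subset hs hg.continuous hgc hgs (hddu i)
  have I2 : ∀ i, Integrable (fun x => fderiv ℝ g x (e i) * fderiv ℝ u x (e i)) :=
    fun i => integrable_mul_of_tsupport_subset hs (hdgi i).continuous (hcd i)
      ((htd i).trans hgs) (hdui i).continuousOn
  have I3 : ∀ i, Integrable (fun x => g x * fderiv ℝ u x (e i)) :=
    fun i => integrable_mul_of_tsupport_subset hs hg.continuous hgc hgs (hdui i).continuousOn
  have I4 : ∀ i, Integrable (fun x => fderiv ℝ (fun y => fderiv ℝ g y (e i)) x (e i) * u x) :=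
    fun i => integrable_mul_of_tsupport_subset hs (hddg i) (hcdd i)
      ((htdd i).trans hgs) hu.continuousOn
  have I5 : ∀ i, Integrable (fun x => fderiv ℝ g x (e i) * u x) :=
    fun i => integrable_mul_of_tsupport_subset hs (hdgi i).continuous (hcd i)
      ((htd i).trans hgs) hu.continuousOn
  have key : ∀ i, ∫ x, g x * fderiv ℝ (fun y => fderiv ℝ u y (e i)) x (e i)
      = ∫ x, fderiv ℝ (fun y => fderiv ℝ g y (e i)) x (e i) * u x := by
    intro i
    rw [integral_mul_fderiv_eq_neg_fderiv_mul_of_integrable (I2 i) (I1 i) (I3 i)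
      (fun x _ => hg1 x)
      (fun x hx => ((hdui i).contDiffAt (hs.mem_nhds (hgs hx))).differentiableAt (by norm_num)),
      integral_mul_fderiv_eq_neg_fderiv_mul_of_integrable (I4 i) (I2 i) (I5 i)
      (fun x _ => (hdgi i).differentiable (by norm_num) x)
      (fun x hx => hua x (hgs (htd i hx))), neg_neg]
  have e1 : ∀ x, g x * lap u x
      = ∑ i, g x * fderiv ℝ (fun y => fderiv ℝ u y (e i)) x (e i) := by
    intro x
    by_cases hx : x ∈ tsupport g
    · rw [lap_eq_sum_fderiv (hu.contDiffAt (hs.mem_nhds (hgs hx))), Finset.mul_sum]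
    · simp [image_eq_zero_of_notMem_tsupport hx]
  have e2 : ∀ x, u x * lap g x
      = ∑ i, fderiv ℝ (fun y => fderiv ℝ g y (e i)) x (e i) * u x := by
    intro x
    rw [lap_eq_sum_fderiv hg.contDiffAt, mul_comm, Finset.sum_mul]
  simp_rw [e1, e2]
  rw [integral_finsetSum _ fun i _ => I1 i, integral_finsetSum _ fun i _ => I4 i]
  exact Finset.sum_congr rfl fun i _ => key i

/-- The Laplacian of a radial function `ψ(|y - c|²)`. -/
lemma lap_comp_norm_sub_sq {N : ℕ} {ψ : ℝ → ℝ} (hψ : ContDiff ℝ 2 ψ) (c x : Euc N) :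
    lap (fun y => ψ (‖y - c‖ ^ 2)) x
      = 4 * ‖x - c‖ ^ 2 * deriv (deriv ψ) (‖x - c‖ ^ 2) + 2 * N * deriv ψ (‖x - c‖ ^ 2) := by
  have hn : ∀ y : Euc N, HasFDerivAt (fun y : Euc N => ‖y - c‖ ^ 2)
      (2 • innerSL ℝ (y - c)) y := fun y => by
    exact ((hasFDerivAt_id y).sub_const c).norm_sq
  have hψ1 : ContDiff ℝ 1 (deriv ψ) := (contDiff_succ_iff_deriv (n := 1).1 hψ).2.2
  have hd : ∀ s, HasDerivAt ψ (deriv ψ s) s := fun s =>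
    (hψ.differentiable (by norm_num) s).hasDerivAt
  have hd2 : ∀ s, HasDerivAt (deriv ψ) (deriv (deriv ψ) s) s := fun s =>
    (hψ1.differentiable (by norm_num) s).hasDerivAt
  have hf : ContDiff ℝ 2 (fun y : Euc N => ψ (‖y - c‖ ^ 2)) :=
    hψ.comp ((contDiff_id.sub contDiff_const).norm_sq ℝ)
  rw [lap_eq_sum_fderiv hf.contDiffAt]
  have h1 : ∀ (i : Fin N) (y : Euc N), fderiv ℝ (fun y => ψ (‖y - c‖ ^ 2)) y
      (EuclideanSpace.single i 1) = deriv ψ (‖y - c‖ ^ 2) * (2 * (y i - c i)) := by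
    intro i y
    have h3 := ((hd _).comp_hasFDerivAt y (hn y)).fderiv
    simp only [Function.comp_def] at h3
    rw [h3]
    simp [EuclideanSpace.inner_single_right]
  simp_rw [h1]
  have h2 : ∀ i : Fin N, fderiv ℝ (fun y : Euc N => deriv ψ (‖y - c‖ ^ 2) * (2 * (y i - c i))) x
      (EuclideanSpace.single i 1) = deriv ψ (‖x - c‖ ^ 2) * 2
        + 4 * deriv (deriv ψ) (‖x - c‖ ^ 2) * (x i - c i) ^ 2 := by
    intro i
    have hp : HasFDerivAt (fun y : Euc N => y i) (EuclideanSpace.proj i : Euc N →L[ℝ] ℝ) x :=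
      (EuclideanSpace.proj i : Euc N →L[ℝ] ℝ).hasFDerivAt
    have := ((hd2 _).comp_hasFDerivAt x (hn x)).mul ((hp.sub_const (c i)).const_mul 2)
    have h3 := this.fderiv
    simp only [Function.comp_def] at h3
    erw [h3]
    simp [EuclideanSpace.inner_single_right]
    ring
  simp_rw [h2]
  rw [Finset.sum_add_distrib, ← Finset.mul_sum, ← Finset.mul_sum]
  have : ‖x - c‖ ^ 2 = ∑ i, (x i - c i) ^ 2 := by
    rw [EuclideanSpace.real_norm_sq_eq]; simp
  rw [← this]
  simp
  ring

/-- A fixed smooth cutoff, equal to `1` on the unit ball and supported in the ball of radius `2`. -/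
def unitBump (N : ℕ) : ContDiffBump (0 : Euc N) := ⟨1, 2, one_pos, one_lt_two⟩

/-- The cutoff at scale `r`. -/
def scaledBump (N : ℕ) (r : ℝ) (x : Euc N) : ℝ := unitBump N (r⁻¹ • x)

lemma contDiff_scaledBump (N : ℕ) (r : ℝ) : ContDiff ℝ 2 (scaledBump N r) :=
  (unitBump N).contDiff.comp (contDiff_const_smul _)

lemma scaledBump_nonneg (N : ℕ) (r : ℝ) (x : Euc N) : 0 ≤ scaledBump N r x :=
  (unitBump N).nonneg

lemma scaledBump_le_one (N : ℕ) (r : ℝ) (x : Euc N) : scaledBump N r x ≤ 1 :=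
  (unitBump N).le_one

lemma scaledBump_eq_one {N : ℕ} {r : ℝ} (hr : 0 < r) {x : Euc N} (hx : ‖x‖ ≤ r) :
    scaledBump N r x = 1 := by
  apply (unitBump N).one_of_mem_closedBall
  rw [mem_closedBall_zero_iff, norm_smul, norm_inv, Real.norm_of_nonneg hr.le]
  change r⁻¹ * ‖x‖ ≤ 1
  rw [inv_mul_le_iff₀ hr]; linarith

lemma scaledBump_eq_zero {N : ℕ} {r : ℝ} (hr : 0 < r) {x : Euc N} (hx : 2 * r ≤ ‖x‖) :
    scaledBump N r x = 0 := by
  apply (unitBump N).zero_of_le_dist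
  rw [dist_zero_right, norm_smul, norm_inv, Real.norm_of_nonneg hr.le]
  change 2 ≤ r⁻¹ * ‖x‖
  rw [le_inv_mul_iff₀ hr]; linarith

lemma tsupport_scaledBump_subset {N : ℕ} {r : ℝ} (hr : 0 < r) :
    tsupport (scaledBump N r) ⊆ closedBall 0 (2 * r) := by
  refine closure_minimal (fun x hx => ?_) isClosed_closedBall
  rw [mem_closedBall_zero_iff]
  by_contra h
  exact hx (scaledBump_eq_zero hr (by linarith))

lemma hasCompactSupport_scaledBump {N : ℕ} {r : ℝ} (hr : 0 < r) :
    HasCompactSupport (scaledBump N r) :=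
  (isCompact_closedBall _ _).of_isClosed_subset (isClosed_tsupport _)
    (tsupport_scaledBump_subset hr)

lemma exists_bound_iteratedFDeriv {N : ℕ} {φ : Euc N → ℝ} (hφ : ContDiff ℝ 2 φ)
    (hφc : HasCompactSupport φ) :
    ∃ K : ℝ, 0 ≤ K ∧ ∀ j ≤ 2, ∀ x, ‖iteratedFDeriv ℝ j φ x‖ ≤ K := by
  have : ∀ j ≤ 2, ∃ K : ℝ, ∀ x, ‖iteratedFDeriv ℝ j φ x‖ ≤ K := fun j hj =>
    (hφc.iteratedFDeriv j).exists_bound_of_continuous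
      (hφ.continuous_iteratedFDeriv (by exact_mod_cast hj))
  obtain ⟨K0, h0⟩ := this 0 (by norm_num)
  obtain ⟨K1, h1⟩ := this 1 (by norm_num)
  obtain ⟨K2, h2⟩ := this 2 (by norm_num)
  refine ⟨max K0 (max K1 K2), (norm_nonneg _).trans ((h0 0).trans (le_max_left _ _)), ?_⟩
  intro j hj x
  interval_cases j
  · exact (h0 x).trans (le_max_left _ _)
  · exact (h1 x).trans ((le_max_left _ _).trans (le_max_right _ _))
  · exact (h2 x).trans ((le_max_right _ _).trans (le_max_right _ _))

lemma norm_iteratedFDeriv_scaledBump {N : ℕ} {r : ℝ} (hr : 0 < r) (j : ℕ)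
    (x : Euc N) : ‖iteratedFDeriv ℝ j (scaledBump N r) x‖
      = (r⁻¹) ^ j * ‖iteratedFDeriv ℝ j (unitBump N) (r⁻¹ • x)‖ := by
  have h := iteratedFDeriv_comp_const_smul (𝕜 := ℝ) (i := j) (f := (unitBump N : Euc N → ℝ))
    (r⁻¹) (unitBump N).contDiff
  have h2 := congrFun h x
  change iteratedFDeriv ℝ j (scaledBump N r) x = _ at h2
  rw [h2, norm_smul, norm_pow, norm_inv, Real.norm_of_nonneg hr.le]

lemma exists_abs_lap_scaledBump_le (N : ℕ) :
    ∃ K : ℝ, 0 ≤ K ∧ ∀ r : ℝ, 0 < r → ∀ x, |lap (scaledBump N r) x| ≤ K * (r⁻¹) ^ 2 := by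
  obtain ⟨K, hK, h⟩ := exists_bound_iteratedFDeriv (N := N) (φ := unitBump N)
    (unitBump N).contDiff (unitBump N).hasCompactSupport
  refine ⟨N * K, by positivity, fun r hr x => (abs_lap_le _ x).trans ?_⟩
  rw [norm_iteratedFDeriv_scaledBump hr _]
  have := h 2 le_rfl (r⁻¹ • x)
  calc (N : ℝ) * ((r⁻¹) ^ 2 * ‖iteratedFDeriv ℝ 2 (unitBump N) (r⁻¹ • x)‖)
      ≤ N * ((r⁻¹) ^ 2 * K) := by gcongr
    _ = N * K * (r⁻¹) ^ 2 := by ring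

lemma exists_abs_lap_mul_scaledBump_le {N : ℕ} {φ : Euc N → ℝ} (hφ : ContDiff ℝ 2 φ)
    (hφc : HasCompactSupport φ) :
    ∃ K : ℝ, 0 ≤ K ∧ ∀ r : ℝ, 0 < r → r ≤ 1 → ∀ x,
      |lap (fun y => φ y * scaledBump N r y) x| ≤ K * (r⁻¹) ^ 2 := by
  obtain ⟨K, hK, h⟩ := exists_bound_iteratedFDeriv (N := N) (φ := unitBump N)
    (unitBump N).contDiff (unitBump N).hasCompactSupport
  obtain ⟨L, hL, h'⟩ := exists_bound_iteratedFDeriv hφ hφc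
  refine ⟨N * (4 * (L * K)), by positivity, fun r hr hr1 x => (abs_lap_le _ x).trans ?_⟩
  rw [mul_assoc]
  gcongr
  refine (norm_iteratedFDeriv_mul_le hφ (contDiff_scaledBump N r) x (n := 2) le_rfl).trans ?_
  have h1 : 1 ≤ r⁻¹ := (one_le_inv₀ hr).2 hr1
  have hb : ∀ j ≤ 2, ‖iteratedFDeriv ℝ j (scaledBump N r) x‖ ≤ K * (r⁻¹) ^ 2 := by
    intro j hj
    rw [norm_iteratedFDeriv_scaledBump hr _, mul_comm]
    gcongr
    exact h j hj _
  have hp : ∀ i ≤ 2, ∀ j ≤ 2, ‖iteratedFDeriv ℝ i φ x‖ * ‖iteratedFDeriv ℝ j (scaledBump N r) x‖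
      ≤ L * (K * (r⁻¹) ^ 2) := by
    intro i hi j hj
    exact mul_le_mul (h' i hi x) (hb j hj) (norm_nonneg _) hL
  rw [Finset.sum_range_succ, Finset.sum_range_succ, Finset.sum_range_one]
  have q0 := hp 0 (by norm_num) 2 le_rfl
  have q1 := hp 1 (by norm_num) 1 (by norm_num)
  have q2 := hp 2 le_rfl 0 (by norm_num)
  simp only [Nat.choose_zero_right, Nat.choose_self, Nat.choose_one_right, Nat.sub_zero,
    Nat.cast_one, Nat.cast_ofNat, one_mul, Nat.reduceSub, mul_assoc]
  linarith

lemma isOpen_ne_zero (N : ℕ) : IsOpen {x : Euc N | x ≠ 0} := isOpen_ne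

/-- The distributional inequality for a continuous function that is superharmonic away from the
origin: in dimension at least three the singularity at the origin is removable. -/
lemma setIntegral_mul_neg_lap_le {N : ℕ} (hN : 3 ≤ N) {u : Euc N → ℝ} (huc : Continuous u)
    (hu : ContDiffOn ℝ 2 u {x : Euc N | x ≠ 0}) (hf : ∀ x : Euc N, x ≠ 0 → 0 ≤ -lap u x)
    {φ : Euc N → ℝ} (hφ : ContDiff ℝ 2 φ) (hφc : HasCompactSupport φ) (hφ0 : ∀ x, 0 ≤ φ x)
    {ε : ℝ} (hε : 0 < ε) :
    ∫ x in {x : Euc N | ε ≤ ‖x‖}, φ x * -lap u x ≤ -∫ x, u x * lap φ x := by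
  obtain ⟨K, hK, hKb⟩ := exists_abs_lap_mul_scaledBump_le hφ hφc
  obtain ⟨M, hM⟩ := (isCompact_closedBall (0 : Euc N) 2).exists_bound_of_continuousOn
    huc.continuousOn
  have hM0 : 0 ≤ M := (norm_nonneg _).trans (hM 0 (by simp))
  set ω : ℝ := volume.real (closedBall (0 : Euc N) 1) with hω
  have hfin : Module.finrank ℝ (Euc N) = N := by simp
  -- the estimate at scale `r`
  have main : ∀ r : ℝ, 0 < r → r ≤ 1 → 2 * r ≤ ε →
      ∫ x in {x : Euc N | ε ≤ ‖x‖}, φ x * -lap u x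
        ≤ -(∫ x, u x * lap φ x) + M * K * 2 ^ N * ω * r := by
    intro r hr hr1 hrε
    set g : Euc N → ℝ := fun y => φ y - φ y * scaledBump N r y with hg
    have hgs' : ∀ y, g y = φ y * (1 - scaledBump N r y) := fun y => by rw [hg]; ring
    have hprod : ContDiff ℝ 2 (fun y => φ y * scaledBump N r y) :=
      hφ.mul (contDiff_scaledBump N r)
    have hgC : ContDiff ℝ 2 g := hφ.sub hprod
    have hgc : HasCompactSupport g := by
      have : g = fun y => φ y * (1 - scaledBump N r y) := funext hgs'
      rw [this]; exact hφc.mul_right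
    have hgn : ∀ y, 0 ≤ g y := fun y => by
      rw [hgs']; exact mul_nonneg (hφ0 y) (sub_nonneg.2 (scaledBump_le_one N r y))
    have hgt : tsupport g ⊆ {x : Euc N | x ≠ 0} := by
      have h1 : tsupport g ⊆ {x : Euc N | r ≤ ‖x‖} := by
        refine closure_minimal (fun x hx => ?_) (isClosed_le continuous_const continuous_norm)
        by_contra h
        simp only [mem_ofPred_eq, not_le] at h
        exact hx (by rw [hgs', scaledBump_eq_one hr h.le]; ring)
      intro x hx h0
      have := h1 hx
      simp only [mem_ofPred_eq] at this
      rw [h0, norm_zero] at this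
      linarith
    have hcl : ContinuousOn (lap u) {x : Euc N | x ≠ 0} := continuousOn_lap (isOpen_ne_zero N) hu
    have hint : Integrable (fun x => g x * -lap u x) :=
      integrable_mul_of_tsupport_subset (isOpen_ne_zero N) hgC.continuous hgc hgt hcl.neg
    have hnn : ∀ x, 0 ≤ g x * -lap u x := by
      intro x
      by_cases hx : x = 0
      · have : g x = 0 := by
          by_contra h
          exact hgt (subset_tsupport _ h) hx
        rw [this, zero_mul]
      · exact mul_nonneg (hgn x) (hf x hx)
    have s1 : ∫ x in {x : Euc N | ε ≤ ‖x‖}, φ x * -lap u x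
        = ∫ x in {x : Euc N | ε ≤ ‖x‖}, g x * -lap u x := by
      refine setIntegral_congr_fun (isClosed_le continuous_const continuous_norm).measurableSet
        fun x hx => ?_
      simp only [mem_ofPred_eq] at hx
      simp only [hgs', scaledBump_eq_zero hr (hrε.trans hx), sub_zero, mul_one]
    have s2 : ∫ x in {x : Euc N | ε ≤ ‖x‖}, g x * -lap u x ≤ ∫ x, g x * -lap u x :=
      setIntegral_le_integral hint (Filter.Eventually.of_forall hnn)
    have s3 : ∫ x, g x * -lap u x = -∫ x, u x * lap g x := by
      rw [← integral_mul_lap_comm (isOpen_ne_zero N) hgC hgc hgt hu, ← integral_neg]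
      simp
    have hpc : HasCompactSupport (fun y => φ y * scaledBump N r y) := hφc.mul_right
    have s4 : ∫ x, u x * lap g x
        = (∫ x, u x * lap φ x) - ∫ x, u x * lap (fun y => φ y * scaledBump N r y) x := by
      rw [← integral_sub]
      · refine integral_congr_ae (Filter.Eventually.of_forall fun x => ?_)
        simp only [hg, lap_sub hφ.contDiffAt hprod.contDiffAt]
        ring
      · exact (huc.mul (continuous_lap hφ)).integrable_of_hasCompactSupport
          (hasCompactSupport_lap hφc).mul_left
      · exact (huc.mul (continuous_lap hprod)).integrable_of_hasCompactSupport
          (hasCompactSupport_lap hpc).mul_left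
    have s5 : |∫ x, u x * lap (fun y => φ y * scaledBump N r y) x|
        ≤ M * K * 2 ^ N * ω * r := by
      have hz : ∀ x, x ∉ closedBall (0 : Euc N) (2 * r) →
          u x * lap (fun y => φ y * scaledBump N r y) x = 0 := by
        intro x hx
        rw [lap_eq_zero_of_notMem_tsupport, mul_zero]
        exact fun h => hx (tsupport_scaledBump_subset hr (tsupport_mul_subset_right h))
      rw [← setIntegral_eq_integral_of_forall_compl_eq_zero hz, ← Real.norm_eq_abs]
      refine (norm_setIntegral_le_of_norm_le_const (C := M * (K * (r⁻¹) ^ 2))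
        measure_closedBall_lt_top ?_).trans ?_
      · intro x hx
        rw [norm_mul]
        refine mul_le_mul (hM x (closedBall_subset_closedBall (by linarith) hx))
          (hKb r hr hr1 x) (norm_nonneg _) hM0
      · have hv : volume.real (closedBall (0 : Euc N) (2 * r)) = (2 * r) ^ N * ω := by
          rw [Measure.addHaar_real_closedBall' _ _ (by positivity), hfin]
        rw [hv, mul_pow]
        have hrN : r⁻¹ ^ 2 * r ^ N ≤ r := by
          obtain ⟨m, rfl⟩ : ∃ m, N = 3 + m := ⟨N - 3, by omega⟩
          have : r⁻¹ ^ 2 * r ^ (3 + m) = r * r ^ m := by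
            rw [pow_add]; field_simp
          rw [this]
          exact mul_le_of_le_one_right hr.le (pow_le_one₀ hr.le hr1)
        have hω0 : 0 ≤ ω := measureReal_nonneg
        calc M * (K * r⁻¹ ^ 2) * (2 ^ N * r ^ N * ω) = M * K * 2 ^ N * ω * (r⁻¹ ^ 2 * r ^ N) := by
              ring
          _ ≤ _ := by gcongr
    have := (abs_le.1 s5).2
    linarith
  -- let the scale tend to zero
  refine le_of_forall_pos_le_add fun η hη => ?_
  set B := M * K * 2 ^ N * ω with hB
  have hB0 : 0 ≤ B := by positivity
  have hr : 0 < min (min 1 (ε / 2)) (η / (B + 1)) := by positivity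
  refine (main _ hr ((min_le_left _ _).trans (min_le_left _ _)) ?_).trans ?_
  · have := (min_le_left (min 1 (ε / 2)) (η / (B + 1))).trans (min_le_right _ _)
    linarith
  · gcongr
    calc B * min (min 1 (ε / 2)) (η / (B + 1)) ≤ B * (η / (B + 1)) := by
          gcongr; exact min_le_right _ _
      _ ≤ (B + 1) * (η / (B + 1)) := by gcongr; linarith
      _ = η := by field_simp

lemma integral_mul_lap_nonpos {N : ℕ} (hN : 3 ≤ N) {u : Euc N → ℝ} (huc : Continuous u)
    (hu : ContDiffOn ℝ 2 u {x : Euc N | x ≠ 0}) (hf : ∀ x : Euc N, x ≠ 0 → 0 ≤ -lap u x)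
    {φ : Euc N → ℝ} (hφ : ContDiff ℝ 2 φ) (hφc : HasCompactSupport φ) (hφ0 : ∀ x, 0 ≤ φ x) :
    ∫ x, u x * lap φ x ≤ 0 := by
  have h1 := setIntegral_mul_neg_lap_le hN huc hu hf hφ hφc hφ0 one_pos
  have h2 : 0 ≤ ∫ x in {x : Euc N | 1 ≤ ‖x‖}, φ x * -lap u x := by
    refine setIntegral_nonneg (isClosed_le continuous_const continuous_norm).measurableSet
      fun x hx => mul_nonneg (hφ0 x) (hf x ?_)
    rintro rfl
    simp only [mem_ofPred_eq, norm_zero] at hx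
    linarith
  linarith

/-- Integration in polar coordinates. -/
lemma integral_eq_integral_sphere {N : ℕ} {g : Euc N → ℝ} (hN : 0 < N) (hg : Integrable g) :
    ∫ x, g x = ∫ r in Ioi (0 : ℝ), r ^ (N - 1) *
      ∫ ω : sphere (0 : Euc N) 1, g (r • (ω : Euc N)) ∂(volume : Measure (Euc N)).toSphere := by
  have : Nonempty (Fin N) := ⟨⟨0, hN⟩⟩
  have hfin : Module.finrank ℝ (Euc N) = N := by simp
  have hmp := (volume : Measure (Euc N)).measurePreserving_homeomorphUnitSphereProd
  rw [hfin] at hmp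
  have hem := (homeomorphUnitSphereProd (Euc N)).measurableEmbedding
  set G : sphere (0 : Euc N) 1 × Ioi (0 : ℝ) → ℝ := fun z => g (z.2.1 • (z.1 : Euc N)) with hG
  have hcomp : ∀ x : ({(0 : Euc N)}ᶜ : Set (Euc N)), G (homeomorphUnitSphereProd (Euc N) x)
      = g x := by
    intro x
    have : ((homeomorphUnitSphereProd (Euc N)).symm (homeomorphUnitSphereProd (Euc N) x) : Euc N)
      = x := by simp
    rw [homeomorphUnitSphereProd_symm_apply_coe] at this
    simp only [hG, this]
  have hGi : Integrable G ((volume : Measure (Euc N)).toSphere.prod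
      (Measure.volumeIoiPow (N - 1))) := by
    rw [← hmp.integrable_comp_emb hem]
    have : G ∘ homeomorphUnitSphereProd (Euc N) = fun x : ({(0 : Euc N)}ᶜ : Set (Euc N)) => g (x : Euc N) :=
      funext hcomp
    rw [this]
    have h2 : IntegrableOn g ({(0 : Euc N)}ᶜ) := hg.integrableOn
    rwa [integrableOn_iff_comap_subtypeVal (measurableSet_singleton _).compl] at h2
  calc ∫ x, g x = ∫ x : ({(0 : Euc N)}ᶜ : Set (Euc N)), g (x : Euc N)
          ∂((volume : Measure (Euc N)).comap Subtype.val) := by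
        rw [integral_subtype_comap (measurableSet_singleton _).compl fun x ↦ g x,
          restrict_compl_singleton]
    _ = ∫ z, G z ∂(volume : Measure (Euc N)).toSphere.prod (Measure.volumeIoiPow (N - 1)) := by
        rw [← hmp.integral_comp hem G]
        simp_rw [hcomp]
    _ = ∫ r : Ioi (0 : ℝ), (∫ ω : sphere (0 : Euc N) 1, g (r.1 • (ω : Euc N))
          ∂(volume : Measure (Euc N)).toSphere) ∂Measure.volumeIoiPow (N - 1) :=
        integral_prod_symm G hGi
    _ = _ := by
      simp only [Measure.volumeIoiPow, ENNReal.ofReal]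
      rw [integral_withDensity_eq_integral_smul,
        integral_subtype_comap measurableSet_Ioi fun a ↦ Real.toNNReal (a ^ (N - 1)) •
          ∫ ω : sphere (0 : Euc N) 1, g (a • (ω : Euc N)) ∂(volume : Measure (Euc N)).toSphere,
        setIntegral_congr_fun measurableSet_Ioi fun x hx ↦ ?_]
      · simp only [NNReal.smul_def, Real.coe_toNNReal _ (pow_nonneg (le_of_lt hx.out) _),
          smul_eq_mul]
      · exact (measurable_subtype_coe.pow_const _).real_toNNReal

/-- The integral of `u` over the sphere of center `c` and radius `r`, with respect to the
normalisation of the unit sphere. -/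
def sphereIntegral {N : ℕ} (u : Euc N → ℝ) (c : Euc N) (r : ℝ) : ℝ :=
  ∫ ω : sphere (0 : Euc N) 1, u (c + r • (ω : Euc N)) ∂(volume : Measure (Euc N)).toSphere

lemma continuous_sphereIntegral {N : ℕ} {u : Euc N → ℝ} (hu : Continuous u) (c : Euc N) :
    Continuous (sphereIntegral u c) := by
  have := continuous_parametric_integral_of_continuous
    (μ := (volume : Measure (Euc N)).toSphere)
    (f := fun (r : ℝ) (ω : sphere (0 : Euc N) 1) => u (c + r • (ω : Euc N)))
    (by fun_prop) (isCompact_univ)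
  simp only [Measure.restrict_univ] at this
  exact this

lemma integrable_sphere {N : ℕ} {u : Euc N → ℝ} (hu : Continuous u) (c : Euc N) (r : ℝ) :
    Integrable (fun ω : sphere (0 : Euc N) 1 => u (c + r • (ω : Euc N)))
      (volume : Measure (Euc N)).toSphere := by
  have : Continuous (fun ω : sphere (0 : Euc N) 1 => u (c + r • (ω : Euc N))) := by fun_prop
  exact this.integrable_of_hasCompactSupport (HasCompactSupport.of_compactSpace _)

lemma integral_mul_eq_sphereIntegral {N : ℕ} (hN : 0 < N) {u h : Euc N → ℝ} (c : Euc N)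
    {k : ℝ → ℝ} (hk : ∀ r : ℝ, 0 < r → ∀ ω : sphere (0 : Euc N) 1, h (c + r • (ω : Euc N)) = k r)
    (hi : Integrable (fun x => u x * h x)) :
    ∫ x, u x * h x = ∫ r in Ioi (0 : ℝ), r ^ (N - 1) * (k r * sphereIntegral u c r) := by
  rw [← integral_add_left_eq_self _ c, integral_eq_integral_sphere hN (hi.comp_add_left c)]
  refine setIntegral_congr_fun measurableSet_Ioi fun r hr => ?_
  simp only [sphereIntegral]
  congr 1
  rw [← integral_const_mul]
  refine integral_congr_ae (Filter.Eventually.of_forall fun ω => ?_)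
  simp only [hk r hr ω]
  ring

/-- For `s₁ < s₂` there is a nonnegative compactly supported radial `C²` function whose Laplacian
is minus a bump near the sphere of radius `√s₁` plus a bump near the sphere of radius `√s₂`. -/
lemma exists_radial_test {N : ℕ} {s₁ s₂ δ : ℝ} (hδ : 0 < δ) (h1 : 2 * δ < s₁)
    (h12 : s₁ < s₂) (c : Euc N) :
    ∃ φ : Euc N → ℝ, ContDiff ℝ 2 φ ∧ HasCompactSupport φ ∧ (∀ x, 0 ≤ φ x) ∧
      ∀ r : ℝ, 0 < r → ∀ ω : sphere (0 : Euc N) 1, lap φ (c + r • (ω : Euc N))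
        = -(4 * (r ^ 2 * (r ^ 2) ^ (-((N : ℝ) / 2))) *
          (max 0 (δ - |r ^ 2 - s₁|) - max 0 (δ - |r ^ 2 - s₂|))) := by
  set β : ℝ → ℝ := fun x => max 0 (δ - |x|) with hβ
  have hβc : Continuous β := by fun_prop
  have hβ0 : ∀ x, 0 ≤ β x := fun x => le_max_left _ _
  have hβz : ∀ x, δ ≤ |x| → β x = 0 := fun x hx => max_eq_left (by linarith)
  have hβi : ∀ x y, IntervalIntegrable β volume x y := fun x y => hβc.intervalIntegrable x y
  set B : ℝ → ℝ := fun x => ∫ t in (0 : ℝ)..x, β t with hB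
  have hBd : ∀ x, HasDerivAt B (β x) x := fun x => hβc.integral_hasStrictDerivAt 0 x |>.hasDerivAt
  have hBdiff : ∀ x y, B y - B x = ∫ t in x..y, β t := fun x y => by
    simp only [hB]; rw [intervalIntegral.integral_interval_sub_left (hβi _ _) (hβi _ _)]
  set G : ℝ → ℝ := fun s => B (s - s₁) - B (s - s₂) with hG
  set g : ℝ → ℝ := fun s => β (s - s₁) - β (s - s₂) with hg
  have hgc : Continuous g := by fun_prop
  have hGd : ∀ s, HasDerivAt G (g s) s := fun s => by
    have a1 := (hBd (s - s₁)).comp_sub_const s s₁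
    have a2 := (hBd (s - s₂)).comp_sub_const s s₂
    exact a1.sub a2
  have hGC : ContDiff ℝ 1 G := by
    rw [contDiff_one_iff_deriv]
    refine ⟨fun s => (hGd s).differentiableAt, ?_⟩
    have : deriv G = g := funext fun s => (hGd s).deriv
    rwa [this]
  have hG0 : ∀ s, 0 ≤ G s := fun s => by
    simp only [hG]
    rw [hBdiff]
    exact intervalIntegral.integral_nonneg (by linarith) fun t _ => hβ0 t
  have hGl : ∀ s, s ≤ δ → G s = 0 := fun s hs => by
    simp only [hG]
    rw [hBdiff]
    refine (intervalIntegral.integral_congr (g := fun _ => (0 : ℝ)) fun t ht => ?_).trans (by simp)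
    rw [uIcc_of_le (by linarith)] at ht
    refine hβz t ?_
    have := ht.2
    rw [abs_of_nonpos (by linarith)]
    linarith
  have hGr : ∀ s, s₂ + δ ≤ s → G s = 0 := fun s hs => by
    simp only [hG]
    rw [hBdiff]
    refine (intervalIntegral.integral_congr (g := fun _ => (0 : ℝ)) fun t ht => ?_).trans (by simp)
    rw [uIcc_of_le (by linarith)] at ht
    refine hβz t ?_
    have := ht.1
    rw [abs_of_nonneg (by linarith)]
    linarith
  set α : ℝ := -((N : ℝ) / 2) with hα
  set P : ℝ → ℝ := fun s => G s * s ^ α with hP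
  have hP0 : ∀ s, 0 ≤ P s := fun s => by
    rcases le_or_gt s 0 with hs | hs
    · simp [hP, hGl s (by linarith)]
    · exact mul_nonneg (hG0 s) (Real.rpow_nonneg hs.le _)
  have hPC : ContDiff ℝ 1 P := by
    rw [contDiff_iff_contDiffAt]
    intro s
    rcases lt_or_ge s δ with hs | hs
    · have : P =ᶠ[𝓝 s] fun _ => 0 := by
        filter_upwards [Iio_mem_nhds hs] with t ht
        simp [hP, hGl t (le_of_lt ht)]
      exact contDiffAt_const.congr_of_eventuallyEq this
    · exact hGC.contDiffAt.mul (Real.contDiffAt_rpow_const_of_ne (by linarith))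
  have hPd : ∀ s, 0 < s → HasDerivAt P (g s * s ^ α + G s * (α * s ^ (α - 1))) s := fun s hs =>
    (hGd s).mul (Real.hasDerivAt_rpow_const (Or.inl hs.ne'))
  set T : ℝ := s₂ + δ with hT
  set ψ : ℝ → ℝ := fun s => ∫ t in s..T, P t with hψ
  have hψd : ∀ s, HasDerivAt ψ (-P s) s := fun s =>
    intervalIntegral.integral_hasDerivAt_left (hPC.continuous.intervalIntegrable _ _)
      hPC.continuous.aestronglyMeasurable.stronglyMeasurableAtFilter hPC.continuous.continuousAt
  have hψ' : deriv ψ = fun s => -P s := funext fun s => (hψd s).deriv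
  have hψC : ContDiff ℝ 2 ψ := by
    have : ContDiff ℝ (1 + 1) ψ := by
      rw [contDiff_succ_iff_deriv]
      refine ⟨fun s => (hψd s).differentiableAt, by simp, ?_⟩
      rw [hψ']
      exact hPC.neg
    exact this
  have hψz : ∀ s, T ≤ s → ψ s = 0 := fun s hs => by
    simp only [hψ]
    refine (intervalIntegral.integral_congr (g := fun _ => (0 : ℝ)) fun t ht => ?_).trans (by simp)
    rw [uIcc_of_ge hs] at ht
    simp [hP, hGr t ht.1]
  have hψ0 : ∀ s, 0 ≤ ψ s := fun s => by
    rcases le_or_gt T s with h | h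
    · rw [hψz s h]
    · exact intervalIntegral.integral_nonneg h.le fun t _ => hP0 t
  refine ⟨fun x => ψ (‖x - c‖ ^ 2), hψC.comp ((contDiff_id.sub contDiff_const).norm_sq ℝ), ?_,
    fun x => hψ0 _, ?_⟩
  · refine HasCompactSupport.intro (isCompact_closedBall c (T + 1)) fun x hx => hψz _ ?_
    rw [mem_closedBall, dist_eq_norm, not_le] at hx
    have hT0 : 0 < T := by rw [hT]; linarith
    nlinarith
  · intro r hr ω
    rw [lap_comp_norm_sub_sq hψC]
    have hn : ‖c + r • (ω : Euc N) - c‖ = r := by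
      have : ‖(ω : Euc N)‖ = 1 := by simp
      rw [add_sub_cancel_left, norm_smul, this, mul_one, Real.norm_of_nonneg hr.le]
    rw [hn]
    have hr2 : 0 < r ^ 2 := by positivity
    have hd2 : deriv (deriv ψ) (r ^ 2)
        = -(g (r ^ 2) * (r ^ 2) ^ α + G (r ^ 2) * (α * (r ^ 2) ^ (α - 1))) := by
      rw [hψ']
      exact ((hPd _ hr2).neg).deriv
    rw [hd2, hψ']
    have hαr : r ^ 2 * (r ^ 2) ^ (α - 1) = (r ^ 2) ^ α := by
      rw [Real.rpow_sub_one hr2.ne']; field_simp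
    have hN2 : (N : ℝ) = -(2 * α) := by rw [hα]; ring
    simp only [hP]
    rw [hN2]
    change _ = -(4 * (r ^ 2 * (r ^ 2) ^ α) * g (r ^ 2))
    linear_combination (-4 * G (r ^ 2) * α) * hαr

/-- Spherical means of superharmonic functions are nonincreasing in the radius. -/
lemma sphereIntegral_anti {N : ℕ} (hN : 3 ≤ N) {u : Euc N → ℝ} (huc : Continuous u)
    (hu : ContDiffOn ℝ 2 u {x : Euc N | x ≠ 0}) (hf : ∀ x : Euc N, x ≠ 0 → 0 ≤ -lap u x)
    (c : Euc N) {r₁ r₂ : ℝ} (hr₁ : 0 < r₁) (hr : r₁ < r₂) :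
    sphereIntegral u c r₂ ≤ sphereIntegral u c r₁ := by
  by_contra! hlt
  have : Nonempty (Fin N) := ⟨⟨0, by omega⟩⟩
  set σ := (volume : Measure (Euc N)).toSphere with hσ
  have hσ0 : 0 < σ.real univ := by
    rw [measureReal_def]
    refine ENNReal.toReal_pos ?_ (measure_ne_top _ _)
    rw [Ne, Measure.measure_univ_eq_zero]
    exact Measure.toSphere_ne_zero _
  set m := (sphereIntegral u c r₁ + sphereIntegral u c r₂) / 2 with hm
  set w : Euc N → ℝ := fun x => u x - m / σ.real univ with hw
  have hwc : Continuous w := by fun_prop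
  have hwC : ContDiffOn ℝ 2 w {x : Euc N | x ≠ 0} := hu.sub contDiffOn_const
  have hlc : ∀ x, lap (fun _ : Euc N => m / σ.real univ) x = 0 := fun x => by
    simp [lap, iteratedFDeriv_const_of_ne]
  have hwf : ∀ x : Euc N, x ≠ 0 → 0 ≤ -lap w x := fun x hx => by
    rw [hw, lap_sub (hu.contDiffAt ((isOpen_ne_zero N).mem_nhds hx)) contDiffAt_const, hlc,
      sub_zero]
    exact hf x hx
  have hSw : ∀ r, sphereIntegral w c r = sphereIntegral u c r - m := fun r => by
    simp only [sphereIntegral, hw]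
    rw [integral_sub (integrable_sphere huc c r) (integrable_const _), integral_const, smul_eq_mul,
      mul_div_cancel₀ _ hσ0.ne']
  have hScont : Continuous (fun s : ℝ => sphereIntegral w c (Real.sqrt s)) :=
    (continuous_sphereIntegral hwc c).comp Real.continuous_sqrt
  have hr₂ : 0 < r₂ := hr₁.trans hr
  have e1 : ∀ᶠ s in 𝓝 (r₁ ^ 2), sphereIntegral w c (Real.sqrt s) < 0 := by
    refine hScont.continuousAt.eventually_lt continuousAt_const ?_
    rw [Real.sqrt_sq hr₁.le, hSw]; linarith
  have e2 : ∀ᶠ s in 𝓝 (r₂ ^ 2), 0 < sphereIntegral w c (Real.sqrt s) := by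
    refine continuousAt_const.eventually_lt hScont.continuousAt ?_
    rw [Real.sqrt_sq hr₂.le, hSw]; linarith
  obtain ⟨δ₁, hδ₁, h₁⟩ := Metric.eventually_nhds_iff.1 e1
  obtain ⟨δ₂, hδ₂, h₂⟩ := Metric.eventually_nhds_iff.1 e2
  set δ := min (min δ₁ δ₂) (r₁ ^ 2 / 4) with hδ
  have hr1sq : 0 < r₁ ^ 2 := by positivity
  have hδ0 : 0 < δ := by positivity
  have hδ1 : δ ≤ δ₁ := (min_le_left _ _).trans (min_le_left _ _)
  have hδ2 : δ ≤ δ₂ := (min_le_left _ _).trans (min_le_right _ _)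
  have hδ3 : δ ≤ r₁ ^ 2 / 4 := min_le_right _ _
  obtain ⟨φ, hφC, hφc, hφ0, hφl⟩ := exists_radial_test (N := N) (s₁ := r₁ ^ 2) (s₂ := r₂ ^ 2)
    hδ0 (by linarith) (by nlinarith) c
  have hle := integral_mul_lap_nonpos hN hwc hwC hwf hφC hφc hφ0
  have hint : Integrable (fun x => w x * lap φ x) :=
    (hwc.mul (continuous_lap hφC)).integrable_of_hasCompactSupport
      (hasCompactSupport_lap hφc).mul_left
  rw [integral_mul_eq_sphereIntegral (by omega) c hφl hint] at hle
  set K : ℝ → ℝ := fun r => max 0 (δ - |r ^ 2 - r₁ ^ 2|) - max 0 (δ - |r ^ 2 - r₂ ^ 2|) with hK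
  have hpow : ∀ r : ℝ, 0 < r → r ^ (N - 1) * (r ^ 2 * (r ^ 2) ^ (-((N : ℝ) / 2))) = r := by
    intro r hr
    have a1 : (r ^ 2) ^ (-((N : ℝ) / 2)) = (r ^ N)⁻¹ := by
      rw [← Real.rpow_natCast r 2, ← Real.rpow_mul hr.le, ← Real.rpow_natCast r N,
        ← Real.rpow_neg hr.le]
      congr 1; push_cast; ring
    rw [a1]
    obtain ⟨k, rfl⟩ : ∃ k, N = k + 1 := ⟨N - 1, by omega⟩
    rw [Nat.add_sub_cancel]
    field_simp
    ring
  have hcongr : ∫ r in Ioi (0 : ℝ), r ^ (N - 1) *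
      (-(4 * (r ^ 2 * (r ^ 2) ^ (-((N : ℝ) / 2))) * K r) * sphereIntegral w c r)
      = ∫ r in Ioi (0 : ℝ), 4 * r * (-(K r * sphereIntegral w c r)) := by
    refine setIntegral_congr_fun measurableSet_Ioi fun r hr => ?_
    have := hpow r hr
    linear_combination (-4 * K r * sphereIntegral w c r) * this
  rw [hcongr] at hle
  set h : ℝ → ℝ := fun r => 4 * r * (-(K r * sphereIntegral w c r)) with hh
  have hSc := continuous_sphereIntegral hwc c
  have hhc : Continuous h := by fun_prop
  have hhs : HasCompactSupport h := by
    refine HasCompactSupport.intro (isCompact_Icc (a := -(r₂ ^ 2 + r₁ ^ 2 + 1))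
      (b := r₂ ^ 2 + r₁ ^ 2 + 1)) fun r hr => ?_
    have hbig : r₂ ^ 2 + r₁ ^ 2 + 1 < |r| := by
      by_contra! hb
      exact hr (abs_le.1 hb)
    have hb2 : r₂ ^ 2 + r₁ ^ 2 + 1 < r ^ 2 := by
      have h1 : 1 < |r| := by nlinarith [sq_nonneg r₂]
      have h2 := sq_abs r
      nlinarith
    have hz : K r = 0 := by
      have t1 : δ - |r ^ 2 - r₁ ^ 2| ≤ 0 := by
        have := le_abs_self (r ^ 2 - r₁ ^ 2)
        nlinarith
      have t2 : δ - |r ^ 2 - r₂ ^ 2| ≤ 0 := by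
        have := le_abs_self (r ^ 2 - r₂ ^ 2)
        nlinarith
      simp [hK, max_eq_left t1, max_eq_left t2]
    simp [hh, hz]
  have hneg : ∀ r : ℝ, 0 < r → 0 ≤ -(K r * sphereIntegral w c r) := by
    intro r hr'
    have q1 : max 0 (δ - |r ^ 2 - r₁ ^ 2|) * sphereIntegral w c r ≤ 0 := by
      rcases le_or_gt δ |r ^ 2 - r₁ ^ 2| with hd | hd
      · rw [max_eq_left (by linarith), zero_mul]
      · have := h₁ (y := r ^ 2) (by rw [Real.dist_eq]; linarith)
        rw [Real.sqrt_sq hr'.le] at this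
        exact mul_nonpos_of_nonneg_of_nonpos (le_max_left _ _) this.le
    have q2 : 0 ≤ max 0 (δ - |r ^ 2 - r₂ ^ 2|) * sphereIntegral w c r := by
      rcases le_or_gt δ |r ^ 2 - r₂ ^ 2| with hd | hd
      · rw [max_eq_left (by linarith), zero_mul]
      · have := h₂ (y := r ^ 2) (by rw [Real.dist_eq]; linarith)
        rw [Real.sqrt_sq hr'.le] at this
        exact mul_nonneg (le_max_left _ _) this.le
    simp only [hK, sub_mul]
    linarith
  have hpos : 0 < ∫ r in Ioi (0 : ℝ), h r := by
    rw [setIntegral_pos_iff_support_of_nonneg_ae]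
    · refine (hhc.isOpen_support.inter isOpen_Ioi).measure_pos volume ⟨r₁, ?_, hr₁⟩
      have p1 : sphereIntegral w c r₁ < 0 := by rw [hSw]; linarith
      have p2 : K r₁ * sphereIntegral w c r₁ < 0 := by
        refine mul_neg_of_pos_of_neg ?_ p1
        have p3 : δ - |r₁ ^ 2 - r₂ ^ 2| < δ := by
          have : 0 < |r₁ ^ 2 - r₂ ^ 2| := abs_pos.2 (by nlinarith)
          linarith
        simp only [hK, sub_self, abs_zero, sub_zero, max_eq_right hδ0.le, sub_pos]
        exact max_lt hδ0 p3
      have : 0 < h r₁ := mul_pos (by positivity) (by linarith)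
      exact this.ne'
    · filter_upwards [ae_restrict_mem measurableSet_Ioi] with r hr'
      exact mul_nonneg (by have := hr'.out; positivity) (hneg r hr')
    · exact (hhc.integrable_of_hasCompactSupport hhs).integrableOn
  linarith

lemma setIntegral_ball_eq_sphereIntegral {N : ℕ} (hN : 0 < N) {u : Euc N → ℝ}
    (hu : Continuous u) (c : Euc N) {ρ : ℝ} (hρ : 0 < ρ) :
    ∫ x in ball c ρ, u x = ∫ r in (0 : ℝ)..ρ, r ^ (N - 1) * sphereIntegral u c r := by
  have h0 : (fun x => u x * (ball c ρ).indicator (fun _ => (1 : ℝ)) x)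
      = (ball c ρ).indicator u := by
    ext x
    by_cases hx : x ∈ ball c ρ <;> simp [hx]
  have hi : Integrable (fun x => u x * (ball c ρ).indicator (fun _ => (1 : ℝ)) x) := by
    rw [h0, integrable_indicator_iff measurableSet_ball]
    exact (hu.continuousOn.integrableOn_compact (isCompact_closedBall c ρ)).mono_set
      ball_subset_closedBall
  have key := integral_mul_eq_sphereIntegral hN c
    (k := (Iio ρ).indicator (fun _ => (1 : ℝ))) (fun r hr ω => by
      have hm : c + r • (ω : Euc N) ∈ ball c ρ ↔ r ∈ Iio ρ := by
        have : ‖(ω : Euc N)‖ = 1 := by simp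
        rw [mem_ball, dist_eq_norm, add_sub_cancel_left, norm_smul, this, mul_one,
          Real.norm_of_nonneg hr.le, mem_Iio]
      by_cases h : r ∈ Iio ρ
      · rw [indicator_of_mem h, indicator_of_mem (hm.2 h)]
      · rw [indicator_of_notMem h, indicator_of_notMem fun h' => h (hm.1 h')]) hi
  rw [h0, integral_indicator measurableSet_ball] at key
  rw [key, intervalIntegral.integral_of_le hρ.le, integral_Ioc_eq_integral_Ioo,
    ← Ioi_inter_Iio, ← setIntegral_indicator measurableSet_Iio]
  congr 1
  ext r
  by_cases h : r ∈ Iio ρ <;> simp [h]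

lemma sphereIntegral_zero {N : ℕ} (u : Euc N → ℝ) (c : Euc N) :
    sphereIntegral u c 0 = N * (volume.real (ball (0 : Euc N) 1) * u c) := by
  simp only [sphereIntegral, zero_smul, add_zero, integral_const, smul_eq_mul]
  rw [Measure.toSphere_real_apply_univ]
  simp [mul_assoc]

lemma natCast_mul_integral_pow {N : ℕ} (hN : 0 < N) (ρ K : ℝ) :
    ∫ r in (0 : ℝ)..ρ, r ^ (N - 1) * K = ρ ^ N / N * K := by
  obtain ⟨k, rfl⟩ : ∃ k, N = k + 1 := ⟨N - 1, by omega⟩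
  rw [intervalIntegral.integral_mul_const, integral_pow]
  simp

lemma setIntegral_ball_le {N : ℕ} (hN : 3 ≤ N) {u : Euc N → ℝ} (huc : Continuous u)
    (hu : ContDiffOn ℝ 2 u {x : Euc N | x ≠ 0}) (hf : ∀ x : Euc N, x ≠ 0 → 0 ≤ -lap u x)
    (c : Euc N) {ρ : ℝ} (hρ : 0 < ρ) :
    ∫ x in ball c ρ, u x ≤ volume.real (ball (0 : Euc N) 1) * ρ ^ N * u c := by
  have hSc := continuous_sphereIntegral huc c
  have hS0 : ∀ r, 0 < r → sphereIntegral u c r ≤ sphereIntegral u c 0 := fun r hr => by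
    refine ge_of_tendsto (hSc.continuousWithinAt (s := Ioi 0) (x := 0)) ?_
    filter_upwards [Ioo_mem_nhdsGT hr] with s hs
    exact sphereIntegral_anti hN huc hu hf c hs.1 hs.2
  rw [setIntegral_ball_eq_sphereIntegral (by omega) huc c hρ]
  calc _ ≤ ∫ r in (0 : ℝ)..ρ, r ^ (N - 1) * sphereIntegral u c 0 := by
        refine intervalIntegral.integral_mono_on hρ.le ?_ ?_ fun r hr => ?_
        · exact (Continuous.mul (by fun_prop) hSc).intervalIntegrable _ _
        · exact Continuous.intervalIntegrable (by fun_prop) _ _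
        · rcases hr.1.eq_or_lt with h | h
          · rw [← h]
          · exact mul_le_mul_of_nonneg_left (hS0 r h) (pow_nonneg hr.1 _)
    _ = _ := by
        have : (N : ℝ) ≠ 0 := by positivity
        rw [natCast_mul_integral_pow (by omega), sphereIntegral_zero]
        field_simp

lemma sphereIntegral_le {N : ℕ} (hN : 3 ≤ N) {u : Euc N → ℝ} (huc : Continuous u)
    (hu : ContDiffOn ℝ 2 u {x : Euc N | x ≠ 0}) (hf : ∀ x : Euc N, x ≠ 0 → 0 ≤ -lap u x)
    (c : Euc N) {ρ : ℝ} (hρ : 0 < ρ) :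
    ρ ^ N / N * sphereIntegral u c ρ ≤ ∫ x in ball c ρ, u x := by
  have hSc := continuous_sphereIntegral huc c
  rw [setIntegral_ball_eq_sphereIntegral (by omega) huc c hρ, ← natCast_mul_integral_pow (by omega)]
  refine intervalIntegral.integral_mono_on hρ.le ?_ ?_ fun r hr => ?_
  · exact Continuous.intervalIntegrable (by fun_prop) _ _
  · exact (Continuous.mul (by fun_prop) hSc).intervalIntegrable _ _
  · refine mul_le_mul_of_nonneg_left ?_ (pow_nonneg hr.1 _)
    rcases hr.2.eq_or_lt with h | h
    · rw [h]
    rcases hr.1.eq_or_lt with h0 | h0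
    · rw [← h0]
      refine ge_of_tendsto (hSc.continuousWithinAt (s := Ioi 0) (x := 0)) ?_
      filter_upwards [Ioo_mem_nhdsGT hρ] with s hs
      exact sphereIntegral_anti hN huc hu hf c hs.1 hs.2
    · exact sphereIntegral_anti hN huc hu hf c h0 h

lemma setIntegral_ball_zero_le {N : ℕ} (hN : 3 ≤ N) {u : Euc N → ℝ} (huc : Continuous u)
    (hu : ContDiffOn ℝ 2 u {x : Euc N | x ≠ 0}) (hf : ∀ x : Euc N, x ≠ 0 → 0 ≤ -lap u x)
    (hu0 : ∀ x, 0 ≤ u x) {R : ℝ} (hR : 0 < R) {x : Euc N} (hx : ‖x‖ ≤ 2 * R) :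
    ∫ y in closedBall 0 (2 * R), u y ≤ volume.real (ball (0 : Euc N) 1) * (5 * R) ^ N * u x := by
  refine le_trans ?_ (setIntegral_ball_le hN huc hu hf x (by positivity))
  refine setIntegral_mono_set ?_ (Filter.Eventually.of_forall hu0) ?_
  · exact (huc.continuousOn.integrableOn_compact (isCompact_closedBall x (5 * R))).mono_set
      ball_subset_closedBall
  · refine LE.le.eventuallyLE fun y hy => ?_
    rw [mem_closedBall_zero_iff] at hy
    rw [mem_ball, dist_eq_norm]
    linarith [norm_sub_le y x]

/-- The energy of a nonnegative superharmonic function on a ball is controlled by any of its values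
on the ball of twice the radius. -/
lemma exists_energy_le {N : ℕ} (hN : 3 ≤ N) :
    ∃ C : ℝ, 0 < C ∧ ∀ u : Euc N → ℝ, Continuous u → ContDiffOn ℝ 2 u {x : Euc N | x ≠ 0} →
      (∀ x : Euc N, x ≠ 0 → 0 ≤ -lap u x) → (∀ x, 0 ≤ u x) → ∀ R : ℝ, 0 < R →
      ∀ x : Euc N, ‖x‖ ≤ 2 * R → ∀ ε : ℝ, 0 < ε →
      ∫ y in {y | ε ≤ ‖y‖} ∩ ball 0 R, -lap u y ≤ C * R ^ ((N : ℝ) - 2) * u x := by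
  obtain ⟨K, hK, hKb⟩ := exists_abs_lap_scaledBump_le N
  set ω := volume.real (ball (0 : Euc N) 1) with hω
  have hω0 : 0 ≤ ω := measureReal_nonneg
  refine ⟨K * ω * 5 ^ N + 1, by positivity, fun u huc hu hf hu0 R hR x hx ε hε => ?_⟩
  set φ := scaledBump N R with hφ
  have hφC : ContDiff ℝ 2 φ := (contDiff_scaledBump N R).of_le (by simp)
  have hφc : HasCompactSupport φ := hasCompactSupport_scaledBump hR
  have h1 := setIntegral_mul_neg_lap_le hN huc hu hf hφC hφc (scaledBump_nonneg N R) hε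
  have hclosed : IsClosed {y : Euc N | ε ≤ ‖y‖} := isClosed_le continuous_const continuous_norm
  have hlc : ContinuousOn (fun y => -lap u y) {y : Euc N | ε ≤ ‖y‖} :=
    (continuousOn_lap (isOpen_ne_zero N) hu).neg.mono fun y (hy : ε ≤ ‖y‖) h0 => by
      rw [h0, norm_zero] at hy
      linarith
  have hint : IntegrableOn (fun y => φ y * -lap u y) {y : Euc N | ε ≤ ‖y‖} := by
    have hc : IsCompact ({y : Euc N | ε ≤ ‖y‖} ∩ closedBall 0 (2 * R)) :=
      (isCompact_closedBall _ _).inter_left hclosed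
    have : IntegrableOn (fun y => φ y * -lap u y)
        ({y : Euc N | ε ≤ ‖y‖} ∩ closedBall 0 (2 * R)) :=
      ((hφC.continuous.continuousOn.mul hlc).mono inter_subset_left).integrableOn_compact hc
    refine this.of_forall_sdiff_eq_zero hclosed.measurableSet fun y hy => ?_
    have : 2 * R < ‖y‖ := by
      by_contra! h
      exact hy.2 ⟨hy.1, mem_closedBall_zero_iff.2 h⟩
    rw [hφ, scaledBump_eq_zero hR this.le, zero_mul]
  have h2 : ∫ y in {y | ε ≤ ‖y‖} ∩ ball 0 R, -lap u y
      ≤ ∫ y in {y | ε ≤ ‖y‖}, φ y * -lap u y := by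
    calc ∫ y in {y | ε ≤ ‖y‖} ∩ ball 0 R, -lap u y
        = ∫ y in {y | ε ≤ ‖y‖} ∩ ball 0 R, φ y * -lap u y := by
          refine setIntegral_congr_fun (hclosed.measurableSet.inter measurableSet_ball)
            fun y hy => ?_
          have : ‖y‖ < R := mem_ball_zero_iff.1 hy.2
          simp only [hφ, scaledBump_eq_one hR this.le, one_mul]
      _ ≤ _ := by
          refine setIntegral_mono_set hint ?_ (inter_subset_left.eventuallyLE)
          filter_upwards [ae_restrict_mem hclosed.measurableSet] with y (hy : ε ≤ ‖y‖)
          refine mul_nonneg (scaledBump_nonneg N R y) (hf y fun h0 => ?_)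
          rw [h0, norm_zero] at hy
          linarith
  have h3 : -∫ y, u y * lap φ y ≤ K * (R⁻¹) ^ 2 * ∫ y in closedBall 0 (2 * R), u y := by
    rw [← integral_neg, ← setIntegral_eq_integral_of_forall_compl_eq_zero
      (s := closedBall 0 (2 * R)), ← integral_const_mul]
    · refine setIntegral_mono_on ?_ ?_ measurableSet_closedBall fun y _ => ?_
      · exact ((huc.mul (continuous_lap hφC)).neg.continuousOn).integrableOn_compact
          (isCompact_closedBall _ _)
      · exact (Continuous.continuousOn (by fun_prop)).integrableOn_compact
          (isCompact_closedBall _ _)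
      · have := (neg_le_abs _).trans (hKb R hR y)
        nlinarith [hu0 y]
    · intro y hy
      rw [lap_eq_zero_of_notMem_tsupport fun h => hy (tsupport_scaledBump_subset hR h)]
      simp
  have h4 := setIntegral_ball_zero_le hN huc hu hf hu0 hR hx
  have hRp : (R⁻¹) ^ 2 * R ^ N = R ^ ((N : ℝ) - 2) := by
    rw [Real.rpow_sub hR, Real.rpow_natCast, Real.rpow_two, inv_pow]
    field_simp
  calc _ ≤ K * (R⁻¹) ^ 2 * (ω * (5 * R) ^ N * u x) := by
        refine (h2.trans h1).trans (h3.trans ?_)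
        exact mul_le_mul_of_nonneg_left h4 (by positivity)
    _ = K * ω * 5 ^ N * R ^ ((N : ℝ) - 2) * u x := by rw [← hRp, mul_pow]; ring
    _ ≤ _ := by
        have := hu0 x
        gcongr
        linarith

lemma abs_rpow_sub_one_mul_self {t p : ℝ} (ht : 0 ≤ t) (hp : 0 < p) :
    |t| ^ (p - 1) * t = t ^ p := by
  rcases ht.eq_or_lt with rfl | h
  · rw [mul_zero, Real.zero_rpow hp.ne']
  · rw [abs_of_pos h, Real.rpow_sub_one h.ne', div_mul_cancel₀ _ h.ne']

lemma two_rpow_neg_abs_mul_rpow_le {R s a : ℝ} (hR : 0 < R) (hs : R / 2 ≤ s) (hsR : s ≤ R) :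
    2 ^ (-|a|) * R ^ a ≤ s ^ a := by
  have hs0 : 0 < s := by linarith
  rcases le_total 0 a with ha | ha
  · rw [abs_of_nonneg ha, Real.rpow_neg two_pos.le, ← Real.inv_rpow two_pos.le,
      ← Real.mul_rpow (by norm_num) hR.le]
    exact Real.rpow_le_rpow (by positivity) (by linarith) ha
  · have h1 : R ^ a ≤ s ^ a := Real.rpow_le_rpow_of_nonpos hs0 hsR ha
    have h2 : (2 : ℝ) ^ (-|a|) ≤ 1 :=
      Real.rpow_le_one_of_one_le_of_nonpos one_le_two (by simp)
    have := Real.rpow_nonneg hR.le a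
    nlinarith

/-- Lower bound for one component of the system in terms of a lower bound for the other one. -/
lemma exists_mul_rpow_le {N : ℕ} (hN : 3 ≤ N) {p : ℝ} (hp : 0 < p) (a : ℝ) :
    ∃ c : ℝ, 0 < c ∧ ∀ u v : Euc N → ℝ, Continuous u → ContDiffOn ℝ 2 u {x : Euc N | x ≠ 0} →
      (∀ x : Euc N, x ≠ 0 → -lap u x = ‖x‖ ^ a * v x ^ p) → (∀ x, 0 ≤ u x) → (∀ x, 0 ≤ v x) →
      ∀ R : ℝ, 0 < R → ∀ m : ℝ, 0 ≤ m → (∀ y, ‖y‖ ≤ R → m ≤ v y) →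
      ∀ x : Euc N, ‖x‖ ≤ 2 * R → c * R ^ (2 + a) * m ^ p ≤ u x := by
  obtain ⟨C, hC, h⟩ := exists_energy_le hN
  set ω := volume.real (ball (0 : Euc N) 1) with hω
  have hω0 : 0 < ω :=
    ENNReal.toReal_pos (measure_ball_pos _ _ one_pos).ne' measure_ball_lt_top.ne
  have h2N : (2 : ℝ)⁻¹ ^ N < 1 := pow_lt_one₀ (by norm_num) (by norm_num) (by omega)
  refine ⟨2 ^ (-|a|) * (ω * (1 - 2⁻¹ ^ N)) / C, ?_, ?_⟩
  · have : 0 < 1 - (2 : ℝ)⁻¹ ^ N := by linarith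
    positivity
  intro u v huc hu heq hu0 hv0 R hR m hm hmv x hx
  have hE := h u huc hu (fun y hy => by
    rw [heq y hy]
    have := hv0 y
    positivity) hu0 R hR x hx (R / 2) (by positivity)
  set A : Set (Euc N) := {y | R / 2 ≤ ‖y‖} ∩ ball 0 R with hA
  have hAdiff : A = ball 0 R \ ball 0 (R / 2) := by
    ext y
    simp [hA, and_comm]
  have hAm : MeasurableSet A := by
    rw [hAdiff]
    exact measurableSet_ball.diff measurableSet_ball
  have hAfin : volume A ≠ ⊤ :=
    ((measure_mono inter_subset_right).trans_lt measure_ball_lt_top).ne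
  have hball : ∀ r : ℝ, 0 < r → volume.real (ball (0 : Euc N) r) = r ^ N * ω := fun r hr => by
    rw [measureReal_def, Measure.addHaar_ball_of_pos _ _ hr, finrank_euclideanSpace_fin,
      ENNReal.toReal_mul, ENNReal.toReal_ofReal (by positivity), hω, measureReal_def]
  have hAvol : volume.real A = ω * (1 - 2⁻¹ ^ N) * R ^ N := by
    rw [hAdiff, measureReal_sdiff (ball_subset_ball (by linarith)) measurableSet_ball,
      hball R hR, hball (R / 2) (by positivity), div_eq_mul_inv, mul_pow]
    ring
  have hmem : ∀ y ∈ A, y ≠ 0 := fun y hy h0 => by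
    have : R / 2 ≤ ‖y‖ := hy.1
    rw [h0, norm_zero] at this
    linarith
  have hAint : IntegrableOn (fun y => -lap u y) A := by
    have hc : IsCompact ({y : Euc N | R / 2 ≤ ‖y‖} ∩ closedBall 0 R) :=
      (isCompact_closedBall _ _).inter_left (isClosed_le continuous_const continuous_norm)
    have hsub : {y : Euc N | R / 2 ≤ ‖y‖} ∩ closedBall 0 R ⊆ {x : Euc N | x ≠ 0} :=
      fun y hy h0 => by
        have : R / 2 ≤ ‖y‖ := hy.1
        rw [h0, norm_zero] at this
        linarith
    exact (((continuousOn_lap (isOpen_ne_zero N) hu).neg.mono hsub).integrableOn_compact hc).mono_set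
      (inter_subset_inter_right _ ball_subset_closedBall)
  have hlow : 2 ^ (-|a|) * R ^ a * m ^ p * volume.real A ≤ ∫ y in A, -lap u y := by
    refine setIntegral_ge_of_const_le_real hAm hAfin (fun y hy => ?_) hAint
    have hyR : ‖y‖ ≤ R := (mem_ball_zero_iff.1 hy.2).le
    rw [heq y (hmem y hy)]
    exact mul_le_mul (two_rpow_neg_abs_mul_rpow_le hR hy.1 hyR)
      (Real.rpow_le_rpow hm (hmv y hyR) hp.le) (by positivity) (by positivity)
  rw [hAvol] at hlow
  have hfin := hlow.trans hE
  have hRN : R ^ N = R ^ ((N : ℝ) - 2) * R ^ (2 : ℝ) := by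
    rw [← Real.rpow_add hR, sub_add_cancel, Real.rpow_natCast]
  have hpos : 0 < R ^ ((N : ℝ) - 2) := by positivity
  rw [Real.rpow_add hR, div_mul_eq_mul_div, div_mul_eq_mul_div, div_le_iff₀ hC]
  rw [hRN] at hfin
  refine le_of_mul_le_mul_left ?_ hpos
  linarith

/-- On every ball centred at the origin, the first component of a nonnegative solution takes a
value which is controlled by the natural scaling of the system. -/
lemma exists_le_mul_rpow_neg {N : ℕ} (hN : 3 ≤ N) {p q : ℝ} (a b : ℝ) (hp : 0 < p) (hq : 0 < q)
    (hpq : 1 < p * q) :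
    ∃ K : ℝ, 0 < K ∧ ∀ u v : Euc N → ℝ, IsHLESol p q a b u v → (∀ x, 0 ≤ u x) →
      (∀ x, 0 ≤ v x) → ∀ R : ℝ, 0 < R → ∃ x₀ : Euc N, ‖x₀‖ ≤ R ∧
        u x₀ ≤ K * R ^ (-((2 * (p + 1) + a + p * b) / (p * q - 1))) := by
  obtain ⟨c, hc, h1⟩ := exists_mul_rpow_le hN hp a
  obtain ⟨d, hd, h2⟩ := exists_mul_rpow_le hN hq b
  refine ⟨((c * d ^ p)⁻¹) ^ (p * q - 1)⁻¹, by positivity, fun u v hs hu0 hv0 R hR => ?_⟩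
  obtain ⟨hu, hv, huc, hvc, e1, e2⟩ := hs
  obtain ⟨x₀, hx₀, hmin⟩ := (isCompact_closedBall (0 : Euc N) R).exists_isMinOn
    ⟨0, mem_closedBall_self hR.le⟩ huc.continuousOn
  rw [mem_closedBall_zero_iff] at hx₀
  refine ⟨x₀, hx₀, ?_⟩
  rcases (hu0 x₀).eq_or_lt with h0 | hm
  · rw [← h0]; positivity
  set m := u x₀ with hmdef
  have hvl : ∀ y, ‖y‖ ≤ R → d * R ^ (2 + b) * m ^ q ≤ v y := fun y hy =>
    h2 v u hvc hv (fun x hx => by rw [e2 x hx, abs_rpow_sub_one_mul_self (hu0 x) hq]) hv0 hu0 R hR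
      m hm.le (fun z hz => hmin (mem_closedBall_zero_iff.2 hz)) y (by linarith)
  have hul := h1 u v huc hu
    (fun x hx => by rw [e1 x hx, abs_rpow_sub_one_mul_self (hv0 x) hp]) hu0 hv0 R hR
    (d * R ^ (2 + b) * m ^ q) (by positivity) hvl x₀ (by linarith)
  set k := 2 * (p + 1) + a + p * b with hk
  have hr : 0 < p * q - 1 := by linarith
  have hmain : m ^ (p * q - 1) ≤ (c * d ^ p)⁻¹ * R ^ (-k) := by
    have e : c * R ^ (2 + a) * (d * R ^ (2 + b) * m ^ q) ^ p
        = (c * d ^ p) * R ^ k * m ^ (p * q - 1) * m := by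
      rw [Real.mul_rpow (by positivity) (by positivity), Real.mul_rpow hd.le (by positivity),
        ← Real.rpow_mul hR.le, ← Real.rpow_mul hm.le, Real.rpow_sub_one hm.ne', mul_comm q p,
        show k = (2 + a) + (2 + b) * p by rw [hk]; ring, Real.rpow_add hR (2 + a)]
      field_simp
    rw [e] at hul
    have h3 : c * d ^ p * R ^ k * m ^ (p * q - 1) ≤ 1 := by
      by_contra! hgt
      have := mul_lt_mul_of_pos_right hgt hm
      linarith
    rw [Real.rpow_neg hR.le, ← mul_inv, ← one_div, le_div_iff₀ (by positivity)]
    linarith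
  have := Real.rpow_le_rpow (by positivity) hmain (inv_nonneg.2 hr.le)
  rw [← Real.rpow_mul hm.le, mul_inv_cancel₀ hr.ne', Real.rpow_one,
    Real.mul_rpow (by positivity) (by positivity), ← Real.rpow_mul hR.le] at this
  rwa [div_eq_mul_inv, ← neg_mul]

lemma setIntegral_ball_le_of_forall_annulus {N : ℕ} (hN : 0 < N) {g : Euc N → ℝ} {R M : ℝ}
    (hM : 0 ≤ M) (h : ∀ ε : ℝ, 0 < ε → ∫ y in {y | ε ≤ ‖y‖} ∩ ball 0 R, g y ≤ M) :
    ∫ y in ball 0 R, g y ≤ M := by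
  by_cases hg : IntegrableOn g (ball 0 R)
  swap
  · rwa [integral_undef hg]
  have : Nonempty (Fin N) := ⟨⟨0, hN⟩⟩
  set s : ℕ → Set (Euc N) := fun n => {y | 1 / ((n : ℝ) + 1) ≤ ‖y‖} ∩ ball 0 R with hs
  have hU : ⋃ n, s n = ball 0 R \ {0} := by
    ext y
    simp only [hs, mem_iUnion, mem_inter_iff, mem_sdiff, mem_singleton_iff]
    constructor
    · rintro ⟨n, hn, hy⟩
      refine ⟨hy, fun h0 => ?_⟩
      have hn' : 1 / ((n : ℝ) + 1) ≤ ‖y‖ := hn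
      rw [h0, norm_zero] at hn'
      have : 0 < 1 / ((n : ℝ) + 1) := by positivity
      linarith
    · rintro ⟨hy, h0⟩
      obtain ⟨n, hn⟩ := exists_nat_one_div_lt (norm_pos_iff.2 h0)
      exact ⟨n, hn.le, hy⟩
  have ht := tendsto_setIntegral_of_monotone (μ := volume) (f := g) (s := s)
    (fun n => ((isClosed_le continuous_const continuous_norm).measurableSet).inter
      measurableSet_ball)
    (fun i j hij y hy => ⟨le_trans (b := 1 / ((i : ℝ) + 1)) (Nat.one_div_le_one_div hij) hy.1,
      hy.2⟩) (by rw [hU]; exact hg.mono_set sdiff_subset)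
  have heq : ∫ y in ⋃ n, s n, g y = ∫ y in ball 0 R, g y := by
    rw [hU]
    exact setIntegral_congr_set (sdiff_null_ae_eq_self (measure_singleton _))
  rw [heq] at ht
  exact le_of_tendsto' ht fun n => h _ (by positivity)

lemma integrable_of_isCompact_of_ae_mem {E : Type*} [MetricSpace E] [MeasurableSpace E]
    [BorelSpace E] {S : Set E} (hS : IsCompact S) {μ : Measure E} [IsFiniteMeasure μ]
    (hμ : ∀ᵐ x ∂μ, x ∈ S) {f : E → ℝ} (hf : Continuous f) : Integrable f μ := by
  have := hf.continuousOn.integrableOn_compact (μ := μ) hS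
  rwa [IntegrableOn, Measure.restrict_eq_self_of_ae_mem hμ] at this

lemma integral_indicator_dist_lt {E : Type*} [MetricSpace E] [MeasurableSpace E] [BorelSpace E]
    [SecondCountableTopology E] {S : Set E} {μ ν : Measure E} [IsFiniteMeasure μ]
    [IsFiniteMeasure ν] (hμ : ∀ᵐ x ∂μ, x ∈ S) {r h : ℝ} (hν : ∀ x ∈ S, ν.real (ball x r) = h)
    {f : E → ℝ} (hf : Integrable f μ) :
    ∫ z, {z : E × E | dist z.1 z.2 < r}.indicator (fun z => f z.1) z ∂(μ.prod ν)
      = h * ∫ x, f x ∂μ := by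
  have hD : MeasurableSet {z : E × E | dist z.1 z.2 < r} :=
    (isOpen_lt continuous_dist continuous_const).measurableSet
  rw [integral_prod _ ((hf.comp_fst ν).indicator hD), ← integral_const_mul]
  refine integral_congr_ae ?_
  filter_upwards [hμ] with x hx
  have : (fun y => {z : E × E | dist z.1 z.2 < r}.indicator (fun z => f z.1) (x, y))
      = (ball x r).indicator (fun _ => f x) := by
    ext y
    simp [indicator, dist_comm]
  rw [this, integral_indicator measurableSet_ball, setIntegral_const, smul_eq_mul, hν x hx]

/-- Two finite measures on a compact set for which the measure of a ball depends only on its radius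
are proportional. -/
lemma measureReal_mul_integral_eq {E : Type*} [MetricSpace E] [MeasurableSpace E] [BorelSpace E]
    [SecondCountableTopology E] {S : Set E} (hS : IsCompact S) {μ ν : Measure E}
    [IsFiniteMeasure μ] [IsFiniteMeasure ν] (hμS : ∀ᵐ x ∂μ, x ∈ S) (hνS : ∀ᵐ x ∂ν, x ∈ S)
    (hμ : ∀ x ∈ S, ∀ y ∈ S, ∀ r, μ (ball x r) = μ (ball y r))
    (hν : ∀ x ∈ S, ∀ y ∈ S, ∀ r, ν (ball x r) = ν (ball y r)) {f : E → ℝ} (hf : Continuous f) :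
    μ.real univ * ∫ x, f x ∂ν = ν.real univ * ∫ x, f x ∂μ := by
  rcases eq_or_ne ν 0 with rfl | hν0
  · simp
  obtain ⟨x₀, hx₀⟩ : S.Nonempty := by
    by_contra! h
    refine hν0 (Measure.measure_univ_eq_zero.1 ?_)
    rw [h] at hνS
    simpa [ae_iff] using hνS
  have hfμ := integrable_of_isCompact_of_ae_mem hS hμS hf
  have hfν := integrable_of_isCompact_of_ae_mem hS hνS hf
  have hN : 0 ≤ ν.real univ := measureReal_nonneg
  have hM : 0 ≤ μ.real univ := measureReal_nonneg
  have key : ∀ ε : ℝ, 0 < ε → |μ.real univ * ∫ x, f x ∂ν - ν.real univ * ∫ x, f x ∂μ|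
      ≤ ε * (μ.real univ * ν.real univ) := by
    intro ε hε
    obtain ⟨r, hr, hrf⟩ := Metric.uniformContinuousOn_iff.1
      (hS.uniformContinuousOn_of_continuous hf.continuousOn) ε hε
    set g := μ.real (ball x₀ r) with hg
    set h := ν.real (ball x₀ r) with hh
    have hgS : ∀ x ∈ S, μ.real (ball x r) = g := fun x hx => by
      rw [hg, measureReal_def, measureReal_def, hμ x hx x₀ hx₀]
    have hhS : ∀ x ∈ S, ν.real (ball x r) = h := fun x hx => by
      rw [hh, measureReal_def, measureReal_def, hν x hx x₀ hx₀]
    have hhpos : 0 < h := by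
      refine ENNReal.toReal_pos (fun h0 => hν0 ?_) (measure_ne_top _ _)
      have hS0 : ν S = 0 := hS.measure_zero_of_nhdsWithin fun x hx =>
        ⟨ball x r, mem_nhdsWithin_of_mem_nhds (ball_mem_nhds x hr), by rw [hν x hx x₀ hx₀, h0]⟩
      rw [← Measure.restrict_eq_self_of_ae_mem hνS, Measure.restrict_eq_zero]
      exact hS0
    set D : Set (E × E) := {z | dist z.1 z.2 < r} with hDdef
    have hD : MeasurableSet D := (isOpen_lt continuous_dist continuous_const).measurableSet
    have e1 : ∫ z, D.indicator (fun z => f z.1) z ∂(μ.prod ν) = h * ∫ x, f x ∂μ :=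
      integral_indicator_dist_lt hμS hhS hfμ
    have e2 : ∫ z, D.indicator (fun z => f z.2) z ∂(μ.prod ν) = g * ∫ x, f x ∂ν := by
      rw [← integral_indicator_dist_lt hνS hgS hfν, ← integral_prod_swap]
      refine integral_congr_ae (Filter.Eventually.of_forall fun z => ?_)
      simp [D, indicator, dist_comm]
    have e3 : ∫ z, D.indicator (fun _ => (1 : ℝ)) z ∂(μ.prod ν) = h * μ.real univ := by
      have := integral_indicator_dist_lt hμS hhS (f := fun _ => 1) (integrable_const _)
      simpa using this
    have e4 : g * ν.real univ = h * μ.real univ := by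
      have := integral_indicator_dist_lt hνS hgS (f := fun _ => 1) (integrable_const _)
      rw [← e3, ← integral_prod_swap]
      rw [integral_const, smul_eq_mul, mul_one] at this
      rw [← this]
      refine integral_congr_ae (Filter.Eventually.of_forall fun z => ?_)
      simp [D, indicator, dist_comm]
    have i1 : Integrable (D.indicator fun z : E × E => f z.1) (μ.prod ν) :=
      (hfμ.comp_fst ν).indicator hD
    have i2 : Integrable (D.indicator fun z : E × E => f z.2) (μ.prod ν) :=
      (hfν.comp_snd μ).indicator hD
    have i3 : Integrable (D.indicator fun _ => (1 : ℝ)) (μ.prod ν) :=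
      (integrable_const _).indicator hD
    have e5 : |g * ∫ x, f x ∂ν - h * ∫ x, f x ∂μ| ≤ ε * (h * μ.real univ) := by
      rw [← e1, ← e2, ← e3, ← integral_sub i2 i1, ← integral_const_mul]
      refine (abs_integral_le_integral_abs).trans (integral_mono_ae (i2.sub i1).abs
        (i3.const_mul ε) ?_)
      have hz1 : ∀ᵐ z ∂(μ.prod ν), z.1 ∈ S := Measure.quasiMeasurePreserving_fst.ae hμS
      have hz2 : ∀ᵐ z ∂(μ.prod ν), z.2 ∈ S := Measure.quasiMeasurePreserving_snd.ae hνS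
      filter_upwards [hz1, hz2] with z h1 h2
      by_cases hz : z ∈ D
      · simp only [indicator_of_mem hz, mul_one]
        rw [abs_sub_comm, ← Real.dist_eq]
        exact (hrf _ h1 _ h2 hz).le
      · simp [indicator_of_notMem hz]
    have e6 : h * (μ.real univ * ∫ x, f x ∂ν - ν.real univ * ∫ x, f x ∂μ)
        = ν.real univ * (g * ∫ x, f x ∂ν - h * ∫ x, f x ∂μ) := by
      linear_combination (-∫ x, f x ∂ν) * e4
    have e7 := congrArg abs e6
    rw [abs_mul, abs_mul, abs_of_pos hhpos, abs_of_nonneg hN] at e7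
    refine le_of_mul_le_mul_left ?_ hhpos
    rw [e7]
    nlinarith [mul_le_mul_of_nonneg_left e5 hN]
  refine eq_of_abs_sub_eq_zero (le_antisymm (le_of_forall_pos_le_add fun ε hε => ?_) (abs_nonneg _))
  have hP : 0 < μ.real univ * ν.real univ + 1 := by positivity
  refine (key (ε / (μ.real univ * ν.real univ + 1)) (by positivity)).trans ?_
  rw [div_mul_eq_mul_div, zero_add, div_le_iff₀ hP]
  nlinarith

lemma exists_linearIsometryEquiv_apply_eq {E : Type*} [NormedAddCommGroup E]
    [InnerProductSpace ℝ E] {x y : E} (h : ‖x‖ = ‖y‖) :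
    ∃ L : E ≃ₗᵢ[ℝ] E, L x = y :=
  ⟨(Submodule.span ℝ {x - y})ᗮ.reflection, Submodule.reflection_sub h⟩

lemma hausdorffMeasure_restrict_sphere_ball {N : ℕ} (d : ℝ) {R : ℝ} {x y : Euc N}
    (hx : x ∈ sphere (0 : Euc N) R) (hy : y ∈ sphere (0 : Euc N) R) (r : ℝ) :
    (μH[d] : Measure (Euc N)).restrict (sphere 0 R) (ball x r)
      = (μH[d] : Measure (Euc N)).restrict (sphere 0 R) (ball y r) := by
  rw [mem_sphere_zero_iff_norm] at hx hy
  obtain ⟨L, rfl⟩ := exists_linearIsometryEquiv_apply_eq (hx.trans hy.symm)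
  rw [Measure.restrict_apply measurableSet_ball, Measure.restrict_apply measurableSet_ball,
    ← L.toIsometryEquiv.hausdorffMeasure_image d (ball x r ∩ sphere 0 R)]
  congr 1
  rw [image_inter L.toIsometryEquiv.injective, L.toIsometryEquiv.image_ball,
    L.toIsometryEquiv.image_sphere]
  simp

lemma toSphere_preimage_ball {N : ℕ} {R : ℝ} {x y : Euc N} (h : ‖x‖ = ‖y‖) (r : ℝ) :
    (volume : Measure (Euc N)).toSphere {ω : sphere (0 : Euc N) 1 | R • (ω : Euc N) ∈ ball x r}
      = (volume : Measure (Euc N)).toSphere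
        {ω : sphere (0 : Euc N) 1 | R • (ω : Euc N) ∈ ball y r} := by
  obtain ⟨L, rfl⟩ := exists_linearIsometryEquiv_apply_eq h
  have hm : ∀ z : Euc N,
      MeasurableSet {ω : sphere (0 : Euc N) 1 | R • (ω : Euc N) ∈ ball z r} := fun z =>
    (isOpen_ball.preimage (by fun_prop : Continuous fun ω : sphere (0 : Euc N) 1 =>
      R • (ω : Euc N))).measurableSet
  rw [Measure.toSphere_apply' _ (hm _), Measure.toSphere_apply' _ (hm _)]
  congr 1
  symm
  rw [← L.measurePreserving.measure_preimage_emb L.toHomeomorph.measurableEmbedding]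
  congr 1
  ext z
  simp only [mem_preimage, mem_smul, mem_image, Subtype.exists]
  constructor
  · rintro ⟨t, ht, _, ⟨ω, hω, hb, rfl⟩, hz⟩
    refine ⟨t, ht, L.symm ω, ⟨L.symm ω, by simpa using hω, ?_, rfl⟩, ?_⟩
    · have hb' : R • ω ∈ ball (L x) r := hb
      change R • L.symm ω ∈ ball x r
      rw [mem_ball, ← L.dist_map]
      simpa using hb'
    · apply L.injective
      simpa using hz
  · rintro ⟨t, ht, _, ⟨ω, hω, hb, rfl⟩, rfl⟩
    refine ⟨t, ht, L ω, ⟨L ω, by simpa using hω, ?_, rfl⟩, by simp⟩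
    have hb' : R • ω ∈ ball x r := hb
    change R • L ω ∈ ball (L x) r
    rwa [← map_smul, mem_ball, L.dist_map]

/-- The average on a sphere with respect to the Hausdorff measure is the average over directions. -/
lemma integral_hausdorffMeasure_sphere {N : ℕ} {R : ℝ} (hR : 0 < R) {f : Euc N → ℝ}
    (hf : Continuous f) (hfin : (μH[(N : ℝ) - 1] : Measure (Euc N)) (sphere 0 R) ≠ ⊤) :
    (μH[(N : ℝ) - 1] : Measure (Euc N)).real (sphere 0 R) * sphereIntegral f 0 R
      = (N * volume.real (ball (0 : Euc N) 1)) *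
        ∫ x in sphere (0 : Euc N) R, f x ∂(μH[(N : ℝ) - 1]) := by
  have hmap : Continuous fun ω : sphere (0 : Euc N) 1 => R • (ω : Euc N) := by fun_prop
  set ν : Measure (Euc N) := (volume : Measure (Euc N)).toSphere.map
    fun ω : sphere (0 : Euc N) 1 => R • (ω : Euc N) with hν
  set μ : Measure (Euc N) := (μH[(N : ℝ) - 1] : Measure (Euc N)).restrict (sphere 0 R) with hμ
  have : IsFiniteMeasure μ := ⟨by rwa [hμ, Measure.restrict_apply_univ, lt_top_iff_ne_top]⟩
  have hfν : IsFiniteMeasure ν := Measure.isFiniteMeasure_map _ _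
  have key := measureReal_mul_integral_eq (isCompact_sphere (0 : Euc N) R) (μ := μ) (ν := ν)
    (ae_restrict_mem isClosed_sphere.measurableSet)
    (by
      refine (ae_map_iff hmap.measurable.aemeasurable isClosed_sphere.measurableSet).2 ?_
      refine Filter.Eventually.of_forall fun ω => ?_
      simp [norm_smul, abs_of_pos hR])
    (fun x hx y hy r => hausdorffMeasure_restrict_sphere_ball _ hx hy r)
    (fun x hx y hy r => by
      rw [mem_sphere_zero_iff_norm] at hx hy
      rw [hν, Measure.map_apply hmap.measurable measurableSet_ball,
        Measure.map_apply hmap.measurable measurableSet_ball]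
      exact toSphere_preimage_ball (hx.trans hy.symm) r) hf
  have h1 : μ.real univ = (μH[(N : ℝ) - 1] : Measure (Euc N)).real (sphere 0 R) := by
    rw [hμ, measureReal_restrict_apply_univ]
  have h2 : ν.real univ = N * volume.real (ball (0 : Euc N) 1) := by
    rw [measureReal_def, hν, Measure.map_apply hmap.measurable MeasurableSet.univ, preimage_univ,
      ← measureReal_def, Measure.toSphere_real_apply_univ]
    simp
  have h3 : ∫ x, f x ∂ν = sphereIntegral f 0 R := by
    rw [hν, integral_map hmap.measurable.aemeasurable hf.aestronglyMeasurable]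
    simp [sphereIntegral]
  rw [h1, h2, h3] at key
  exact key

lemma rpow_le_mul_one_add_div {s t γ : ℝ} (hs : 0 ≤ s) (ht : 0 < t) (hγ : 0 < γ) (hγ1 : γ ≤ 1) :
    s ^ γ ≤ t ^ γ * (1 + s / t) := by
  have hst : 0 ≤ s / t := by positivity
  have h : (s / t) ^ γ ≤ 1 + s / t := by
    rcases le_total (s / t) 1 with h | h
    · exact (Real.rpow_le_one hst h hγ.le).trans (by linarith)
    · exact (Real.rpow_le_self_of_one_le h hγ1).trans (by linarith)
  calc s ^ γ = t ^ γ * (s / t) ^ γ := by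
        rw [← Real.mul_rpow ht.le hst, mul_div_cancel₀ _ ht.ne']
    _ ≤ _ := mul_le_mul_of_nonneg_left h (by positivity)

/-- The average of a nonnegative superharmonic function over a sphere is controlled by any of its
values in the ball. -/
lemma average_sphere_le {N : ℕ} (hN : 3 ≤ N) {u : Euc N → ℝ} (huc : Continuous u)
    (hu : ContDiffOn ℝ 2 u {x : Euc N | x ≠ 0}) (hf : ∀ x : Euc N, x ≠ 0 → 0 ≤ -lap u x)
    (hu0 : ∀ x, 0 ≤ u x) {R : ℝ} (hR : 0 < R)
    (hS : 0 < (μH[(N : ℝ) - 1] : Measure (Euc N)).real (sphere 0 R)) {x : Euc N} (hx : ‖x‖ ≤ R) :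
    ∫ y in sphere (0 : Euc N) R, u y ∂(μH[(N : ℝ) - 1])
      ≤ 5 ^ N * u x * (μH[(N : ℝ) - 1] : Measure (Euc N)).real (sphere 0 R) := by
  have hfin : (μH[(N : ℝ) - 1] : Measure (Euc N)) (sphere 0 R) ≠ ⊤ := fun h => by
    rw [measureReal_def, h, ENNReal.toReal_top] at hS
    exact hS.false
  have h1 := integral_hausdorffMeasure_sphere hR huc hfin
  have h2 := sphereIntegral_le hN huc hu hf 0 hR
  have h3 : ∫ y in ball (0 : Euc N) R, u y ≤ ∫ y in closedBall (0 : Euc N) (2 * R), u y := by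
    refine setIntegral_mono_set (huc.continuousOn.integrableOn_compact (isCompact_closedBall _ _))
      (Filter.Eventually.of_forall hu0) (LE.le.eventuallyLE ?_)
    exact ball_subset_closedBall.trans (closedBall_subset_closedBall (by linarith))
  have h4 := h2.trans (h3.trans (setIntegral_ball_zero_le hN huc hu hf hu0 hR (x := x)
    (by linarith)))
  set M := (μH[(N : ℝ) - 1] : Measure (Euc N)).real (sphere 0 R) with hM
  have hω0 : 0 < volume.real (ball (0 : Euc N) 1) :=
    ENNReal.toReal_pos (measure_ball_pos _ _ one_pos).ne' measure_ball_lt_top.ne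
  set ω := volume.real (ball (0 : Euc N) 1) with hω
  have hNpos : (0 : ℝ) < N := by
    have : 0 < N := by omega
    exact_mod_cast this
  have h5 : sphereIntegral u 0 R ≤ N * ω * (5 ^ N * u x) := by
    have hRN : 0 < R ^ N / N := by positivity
    refine le_of_mul_le_mul_left (h4.trans (le_of_eq ?_)) hRN
    rw [mul_pow]
    field_simp
  have h6 : 0 < N * ω := by positivity
  refine le_of_mul_le_mul_left ?_ h6
  rw [← h1]
  nlinarith [mul_le_mul_of_nonneg_left h5 hS.le]

lemma exists_energy_and_average_le {N : ℕ} (hN : 3 ≤ N) {p q : ℝ} (a b : ℝ) (hp : 0 < p)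
    (hq : 0 < q) (hpq : 1 < p * q) :
    ∃ C : ℝ, 0 < C ∧ ∀ u v : Euc N → ℝ, IsHLESol p q a b u v →
      (∀ x, 0 ≤ u x) → (∀ x, 0 ≤ v x) → ∀ R : ℝ, 0 < R →
        ((∫ x in ball (0 : Euc N) R, ‖x‖ ^ a * v x ^ p) ≤
            C * R ^ ((N : ℝ) - 2 - (2 * (p + 1) + a + p * b) / (p * q - 1))) ∧
        (∀ γ : ℝ, 0 < γ → γ ≤ 1 →
          (∫ x in sphere (0 : Euc N) R, u x ^ γ ∂(μH[(N : ℝ) - 1])) /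
              (μH[(N : ℝ) - 1] (sphere (0 : Euc N) R)).toReal ≤
            C * R ^ (-(γ * ((2 * (p + 1) + a + p * b) / (p * q - 1))))) := by
  obtain ⟨E, hE, hEb⟩ := exists_energy_le hN
  obtain ⟨K, hK, hKb⟩ := exists_le_mul_rpow_neg hN a b hp hq hpq
  refine ⟨E * K + (1 + 5 ^ N * K), by positivity, fun u v hs hu0 hv0 R hR => ?_⟩
  obtain ⟨x₀, hx₀, hux₀⟩ := hKb u v hs hu0 hv0 R hR
  obtain ⟨hu, hv, huc, hvc, e1, -⟩ := hs
  set α := (2 * (p + 1) + a + p * b) / (p * q - 1) with hα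
  have heq : ∀ x : Euc N, x ≠ 0 → -lap u x = ‖x‖ ^ a * v x ^ p := fun x hx => by
    rw [e1 x hx, abs_rpow_sub_one_mul_self (hv0 x) hp]
  have hf : ∀ x : Euc N, x ≠ 0 → 0 ≤ -lap u x := fun x hx => by
    have := hv0 x
    rw [heq x hx]
    positivity
  constructor
  · refine setIntegral_ball_le_of_forall_annulus (by omega) (by positivity) fun ε hε => ?_
    have hm : MeasurableSet ({y : Euc N | ε ≤ ‖y‖} ∩ ball 0 R) :=
      (isClosed_le continuous_const continuous_norm).measurableSet.inter measurableSet_ball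
    rw [← setIntegral_congr_fun hm (f := fun y => -lap u y) fun y hy => heq y fun h0 => by
      have h1 : ε ≤ ‖y‖ := hy.1
      rw [h0, norm_zero] at h1
      linarith]
    have hpos : 0 < R ^ ((N : ℝ) - 2 - α) := by positivity
    calc _ ≤ E * R ^ ((N : ℝ) - 2) * u x₀ :=
          hEb u huc hu hf hu0 R hR x₀ (by linarith) ε hε
      _ ≤ E * R ^ ((N : ℝ) - 2) * (K * R ^ (-α)) := by gcongr
      _ = E * K * R ^ ((N : ℝ) - 2 - α) := by
          rw [sub_eq_add_neg ((N : ℝ) - 2) α, Real.rpow_add hR]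
          ring
      _ ≤ _ := by
          refine mul_le_mul_of_nonneg_right ?_ hpos.le
          have : 0 ≤ 1 + 5 ^ N * K := by positivity
          linarith
  · intro γ hγ hγ1
    rw [← measureReal_def]
    set M := (μH[(N : ℝ) - 1] : Measure (Euc N)).real (sphere 0 R) with hM
    have hM0 : 0 ≤ M := measureReal_nonneg
    rcases hM0.eq_or_lt with h0 | hMpos
    · rw [← h0, div_zero]
      positivity
    have hfin : (μH[(N : ℝ) - 1] : Measure (Euc N)) (sphere 0 R) ≠ ⊤ := fun h => by
      rw [hM, measureReal_def, h, ENNReal.toReal_top] at hMpos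
      exact hMpos.false
    set μ : Measure (Euc N) := (μH[(N : ℝ) - 1] : Measure (Euc N)).restrict (sphere 0 R) with hμ
    have : IsFiniteMeasure μ := ⟨by rwa [hμ, Measure.restrict_apply_univ, lt_top_iff_ne_top]⟩
    have hint : ∀ f : Euc N → ℝ, Continuous f → Integrable f μ := fun f hf =>
      integrable_of_isCompact_of_ae_mem (isCompact_sphere (0 : Euc N) R)
        (ae_restrict_mem isClosed_sphere.measurableSet) hf
    have havg := average_sphere_le hN huc hu hf hu0 hR hMpos hx₀
    have ht : 0 < R ^ (-α) := by positivity
    set t := R ^ (-α) with htdef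
    have htγ : t ^ γ = R ^ (-(γ * α)) := by
      rw [htdef, ← Real.rpow_mul hR.le]
      ring_nf
    have hi1 : Integrable (fun x => t ^ γ * (1 + u x / t)) μ := hint _ (by fun_prop)
    have hle : ∫ x, u x ^ γ ∂μ ≤ t ^ γ * (M + (∫ x, u x ∂μ) / t) := by
      calc ∫ x, u x ^ γ ∂μ ≤ ∫ x, t ^ γ * (1 + u x / t) ∂μ :=
            integral_mono (hint _ (huc.rpow_const fun x => Or.inr hγ.le)) hi1
              fun x => rpow_le_mul_one_add_div (hu0 x) ht hγ hγ1
        _ = _ := by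
            rw [integral_const_mul, integral_add (integrable_const _) ((hint u huc).div_const t),
              integral_const, integral_div, smul_eq_mul, mul_one, hμ,
              measureReal_restrict_apply_univ]
    have hle2 : (∫ x, u x ∂μ) / t ≤ 5 ^ N * K * M := by
      rw [div_le_iff₀ ht]
      refine havg.trans ?_
      calc 5 ^ N * u x₀ * M ≤ 5 ^ N * (K * t) * M := by gcongr
        _ = _ := by ring
    rw [div_le_iff₀ hMpos, ← htγ]
    have htγ0 : 0 ≤ t ^ γ := by positivity
    calc ∫ x, u x ^ γ ∂μ ≤ t ^ γ * (M + 5 ^ N * K * M) :=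
          hle.trans (mul_le_mul_of_nonneg_left (by linarith) htγ0)
      _ = (1 + 5 ^ N * K) * t ^ γ * M := by ring
      _ ≤ _ := by
          have hEK : 1 + 5 ^ N * K ≤ E * K + (1 + 5 ^ N * K) := by
            have : 0 < E * K := by positivity
            linarith
          gcongr

/-- Lemma 2.2 (i), (ii): basic energy and spherical-average estimates for nonnegative
solutions of the Hénon–Lane–Emden system, with a constant depending only on `N,p,q,a,b`. -/
theorem stmt_17 (N : ℕ) (hN : 3 ≤ N) (p q a b : ℝ)
    (hp : 0 < p) (hq : 0 < q) (hpq : 1 < p * q)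
    (ha : -2 < a) (hb : -2 < b) :
    ∃ C : ℝ, 0 < C ∧ ∀ u v : Euc N → ℝ, IsHLESol p q a b u v →
      (∀ x, 0 ≤ u x) → (∀ x, 0 ≤ v x) → ∀ R : ℝ, 0 < R →
        ((∫ x in ball (0 : Euc N) R, ‖x‖ ^ b * u x ^ q) ≤
            C * R ^ ((N : ℝ) - 2 - (2 * (q + 1) + b + q * a) / (p * q - 1))) ∧
        ((∫ x in ball (0 : Euc N) R, ‖x‖ ^ a * v x ^ p) ≤
            C * R ^ ((N : ℝ) - 2 - (2 * (p + 1) + a + p * b) / (p * q - 1))) ∧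
        (∀ γ : ℝ, 0 < γ → γ ≤ 1 →
          ((∫ x in sphere (0 : Euc N) R, u x ^ γ ∂(μH[(N : ℝ) - 1])) /
              (μH[(N : ℝ) - 1] (sphere (0 : Euc N) R)).toReal ≤
            C * R ^ (-(γ * ((2 * (p + 1) + a + p * b) / (p * q - 1))))) ∧
          ((∫ x in sphere (0 : Euc N) R, v x ^ γ ∂(μH[(N : ℝ) - 1])) /
              (μH[(N : ℝ) - 1] (sphere (0 : Euc N) R)).toReal ≤
            C * R ^ (-(γ * ((2 * (q + 1) + b + q * a) / (p * q - 1)))))) := by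
  obtain ⟨C, hC, h1⟩ := exists_energy_and_average_le hN a b hp hq hpq
  obtain ⟨D, hD, h2⟩ := exists_energy_and_average_le hN b a hq hp (by rwa [mul_comm])
  refine ⟨C + D, by positivity, fun u v hs hu0 hv0 R hR => ?_⟩
  obtain ⟨c1, c2⟩ := h1 u v hs hu0 hv0 R hR
  obtain ⟨d1, d2⟩ := h2 v u ⟨hs.2.1, hs.1, hs.2.2.2.1, hs.2.2.1, hs.2.2.2.2.2, hs.2.2.2.2.1⟩
    hv0 hu0 R hR
  rw [mul_comm q p] at d1 d2
  have hCle : ∀ s : ℝ, C * R ^ s ≤ (C + D) * R ^ s := fun s =>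
    mul_le_mul_of_nonneg_right (by linarith) (by positivity)
  have hDle : ∀ s : ℝ, D * R ^ s ≤ (C + D) * R ^ s := fun s =>
    mul_le_mul_of_nonneg_right (by linarith) (by positivity)
  exact ⟨d1.trans (hDle _), c1.trans (hCle _), fun γ hγ hγ1 =>
    ⟨(c2 γ hγ hγ1).trans (hCle _), (d2 γ hγ hγ1).trans (hDle _)⟩⟩
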